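/- arXiv:2401.07986 — 2 statements merged into one kernel-verified Lean document; each statement's English description precedes it below -/
import Mathlib

section
/- Let q be a prime power, r a prime dividing q-1, and f ∈ F_q[x] a polynomial that is not an r-th power in the algebraic closure's function field sense (specifically, f = ∏_{i=1}^L p_i^{v_i} with p_1,...,p_L distinct monic irreducibles and not all v_i ≡ 0 mod r). Then the number of x ∈ F_q such that f(x) is a nonzero r-th power in F_q is at most q/r + L·max_i(deg p_i)·√q. -/
open Polynomial

lemma order_inj (r e v A M : ℕ) (hM : M = r * e + 1) (hr : r.Prime) (hv : Nat.Coprime v r)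
    (hA : A + v ≤ e) (a i j a' i' j' : ℕ) (ha : a < A) (ha' : a' < A) (hi : i < r) (hi' : i' < r)
    (h : a + M * j + v * (e * i) = a' + M * j' + v * (e * i')) : a = a' ∧ i = i' ∧ j = j' := by
  have hr0 := hr.pos
  have key : ∀ a i j : ℕ, a < A → i < r → a + M * j + v * (e * i) + v =
      M * (j + v * i / r) + (e * (v * i % r) + (a + v - v * i / r)) ∧
      v * i / r ≤ v ∧ e * (v * i % r) + (a + v - v * i / r) < M ∧ a + v - v * i / r < e := by
    intro a i j ha hi
    have hs : v * i / r ≤ v := Nat.div_le_of_le_mul (by nlinarith)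
    have ht := Nat.mod_lt (v * i) hr0
    have hd := Nat.div_add_mod (v * i) r
    generalize v * i / r = s at hs hd ⊢
    generalize v * i % r = t at ht hd ⊢
    refine ⟨?_, hs, ?_, by omega⟩
    · obtain ⟨b, hb⟩ : ∃ b, a + v = b + s := ⟨a + v - s, by omega⟩
      have : a + v - s = b := by omega
      rw [this]
      have h1 : v * (e * i) = e * (r * s + t) := by rw [hd]; ring
      rw [h1, hM]
      nlinarith
    · have : e * t + e ≤ r * e := by nlinarith
      omega
  obtain ⟨h1, h2, h3, h4⟩ := key a i j ha hi
  obtain ⟨h1', h2', h3', h4'⟩ := key a' i' j' ha' hi'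
  have hMpos : 0 < M := by omega
  have heq : M * (j + v * i / r) + (e * (v * i % r) + (a + v - v * i / r)) =
      M * (j' + v * i' / r) + (e * (v * i' % r) + (a' + v - v * i' / r)) := by omega
  have hq : ∀ m x y b c : ℕ, b < m → c < m → m * x + b = m * y + c → x = y ∧ b = c := by
    intro m x y b c hb hc h
    have e1 : (m * x + b) / m = x := by
      rw [Nat.mul_add_div (by omega), Nat.div_eq_of_lt hb, add_zero]
    have e2 : (m * y + c) / m = y := by
      rw [Nat.mul_add_div (by omega), Nat.div_eq_of_lt hc, add_zero]
    have : x = y := by rw [← e1, h, e2]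
    subst this
    exact ⟨rfl, by omega⟩
  obtain ⟨e1, e2⟩ := hq _ _ _ _ _ h3 h3' heq
  obtain ⟨e3, e4⟩ := hq _ _ _ _ _ h4 h4' e2
  have : i = i' := by
    have h5 : v * i ≡ v * i' [MOD r] := e3
    have h6 : i ≡ i' [MOD r] := Nat.ModEq.cancel_left_of_coprime hv.symm h5
    exact Nat.ModEq.eq_of_lt_of_lt h6 hi hi'
  subst this
  refine ⟨by omega, rfl, by omega⟩

lemma nonvanish {K : Type*} [Field K] (r e v A M J : ℕ) (hM : M = r * e + 1) (hr : r.Prime)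
    (hv : Nat.Coprime v r) (hA : A + v ≤ e) (u : K[X]) (hu : u.coeff 0 ≠ 0)
    (c : Fin A × Fin r × Fin J → K) (hc : c ≠ 0) :
    (∑ k, C (c k) * (X ^ ((k.1 : ℕ) + M * k.2.2) * (X ^ v * u) ^ (e * k.2.1))) ≠ 0 := by
  classical
  let o : Fin A × Fin r × Fin J → ℕ := fun k => (k.1 : ℕ) + M * k.2.2 + v * (e * k.2.1)
  have hne : (Finset.univ.filter fun k => c k ≠ 0).Nonempty := by
    obtain ⟨k, hk⟩ := Function.ne_iff.mp hc
    exact ⟨k, by simpa using hk⟩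
  obtain ⟨k, hk, hmin⟩ := Finset.exists_min_image _ o hne
  intro h0
  have h1 := congrArg (fun P => coeff P (o k)) h0
  simp only [finsetSum_coeff, coeff_zero] at h1
  have hterm : ∀ k' : Fin A × Fin r × Fin J,
      C (c k') * (X ^ ((k'.1 : ℕ) + M * k'.2.2) * (X ^ v * u) ^ (e * k'.2.1 : ℕ)) =
      C (c k') * (X ^ (o k') * u ^ (e * k'.2.1 : ℕ)) := by
    intro k'
    simp only [o, mul_pow, pow_add, pow_mul]
    ring
  rw [Finset.sum_eq_single k] at h1
  · rw [hterm, coeff_C_mul, coeff_X_pow_mul', if_pos le_rfl, Nat.sub_self,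
      coeff_zero_eq_eval_zero, eval_pow, ← coeff_zero_eq_eval_zero] at h1
    simp only [Finset.mem_filter, Finset.mem_univ, true_and] at hk
    exact mul_ne_zero hk (pow_ne_zero _ hu) h1
  · intro k' _ hk'
    rw [hterm, coeff_C_mul, coeff_X_pow_mul']
    split_ifs with hle
    · by_cases hck : c k' = 0
      · simp [hck]
      · exfalso
        have h2 := hmin k' (by simpa using hck)
        have h3 : o k' = o k := le_antisymm hle h2
        obtain ⟨h4, h5, h6⟩ := order_inj r e v A M hM hr hv hA _ _ _ _ _ _ k'.1.2 k.1.2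
          k'.2.1.2 k.2.1.2 h3
        exact hk' (Prod.ext (Fin.ext h4) (Prod.ext (Fin.ext h5) (Fin.ext h6)))
    · simp
  · simp

lemma exists_rel {K : Type*} [Field K] {ι : Type*} [Fintype ι] (w : ι → K[X]) (B : ℕ)
    (hw : ∀ k, (w k).natDegree < B) (hB : B < Fintype.card ι) :
    ∃ c : ι → K, c ≠ 0 ∧ ∑ k, C (c k) * w k = 0 := by
  let Φ : (ι → K) →ₗ[K] (Fin B → K) :=
    { toFun := fun c t => ∑ k, c k * (w k).coeff t
      map_add' := by intro c c'; ext t; simp [add_mul, Finset.sum_add_distrib]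
      map_smul' := by intro a c; ext t; simp [mul_assoc, Finset.mul_sum] }
  have hk : LinearMap.ker Φ ≠ ⊥ := LinearMap.ker_ne_bot_of_finrank_lt (by simpa using hB)
  obtain ⟨c, hc, hc0⟩ := Submodule.exists_mem_ne_zero_of_ne_bot hk
  refine ⟨c, hc0, ?_⟩
  ext t
  simp only [finsetSum_coeff, coeff_C_mul, coeff_zero]
  by_cases ht : t < B
  · exact congrFun (LinearMap.mem_ker.mp hc) ⟨t, ht⟩
  · refine Finset.sum_eq_zero fun k _ => ?_
    rw [coeff_eq_zero_of_natDegree_lt (by have := hw k; omega), mul_zero]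

lemma stepanov {K : Type*} [Field K] [Fintype K] [DecidableEq K] (p s : ℕ) [Fact p.Prime] [CharP K p]
    (r e v A M J : ℕ) (hMp : M = p ^ s) (hK : Fintype.card K = M * M)
    (hM : M = r * e + 1) (hr : r.Prime)
    (hv : Nat.Coprime v r) (hA : A + v ≤ e) (u : K[X]) (hu : u.coeff 0 ≠ 0) (f : K[X])
    (hf : f = X ^ v * u) (hJ : A * M + J + f.natDegree * M < A * r * J) (ζ : K) (hζ : ζ ≠ 0) :
    (Finset.univ.filter fun x : K => (f.eval x) ^ (e * (M + 1)) = ζ).card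
      ≤ A + M * J + f.natDegree * M := by
  have hr0 := hr.pos
  have hie : ∀ i : Fin r, e * i ≤ M := by
    intro i
    have := i.2
    nlinarith
  have hA0 : 0 < A := by
    rcases Nat.eq_zero_or_pos A with h | h
    · subst h; simp at hJ
    · exact h
  have hJ0 : 0 < J := by
    rcases Nat.eq_zero_or_pos J with h | h
    · subst h; simp at hJ
    · exact h
  let w : Fin A × Fin r × Fin J → K[X] := fun k =>
    C (ζ ^ (k.2.1 : ℕ)) * (X ^ ((k.1 : ℕ) * M + k.2.2) * f ^ (M - e * k.2.1))
  obtain ⟨c, hc0, hc⟩ := exists_rel w (A * M + J + f.natDegree * M) (by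
    intro k
    have h1 : (w k).natDegree ≤ ((k.1 : ℕ) * M + k.2.2) + (M - e * k.2.1) * f.natDegree := by
      refine (natDegree_C_mul_le _ _).trans ((natDegree_mul_le).trans ?_)
      exact add_le_add (natDegree_X_pow_le _) natDegree_pow_le
    have h2 : (M - e * k.2.1 : ℕ) * f.natDegree ≤ f.natDegree * M := by
      rw [mul_comm]; exact Nat.mul_le_mul_left _ (Nat.sub_le _ _)
    have h3 := k.1.2
    have h4 := k.2.2.2
    have h5 : (k.1 : ℕ) * M ≤ A * M := Nat.mul_le_mul_right _ h3.le
    omega) (by simpa [mul_assoc] using hJ)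
  let G : K[X] := ∑ k : Fin A × Fin r × Fin J,
    C ((c k) ^ M) * (X ^ ((k.1 : ℕ) + M * k.2.2) * f ^ (e * k.2.1 : ℕ))
  have hG : G ≠ 0 := by
    have := nonvanish r e v A M J hM hr hv hA u hu (fun k => c k ^ M) (by
      intro h
      apply hc0
      ext k
      have := congrFun h k
      simp only [Pi.zero_apply] at this ⊢
      exact (pow_eq_zero_iff (by omega)).mp this)
    simpa only [G, hf] using this
  have hdeg : G.natDegree ≤ A + M * J + f.natDegree * M := by
    refine natDegree_sum_le_of_forall_le _ _ fun k _ => ?_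
    refine (natDegree_C_mul_le _ _).trans ((natDegree_mul_le).trans ?_)
    refine add_le_add ((natDegree_X_pow_le _).trans ?_) (natDegree_pow_le.trans ?_)
    · exact add_le_add k.1.2.le (Nat.mul_le_mul_left _ k.2.2.2.le)
    · rw [mul_comm]; exact Nat.mul_le_mul_left _ (hie _)
  refine le_trans ?_ hdeg
  refine card_le_degree_of_subset_roots ?_
  intro x hx
  have hx' : (f.eval x) ^ (e * (M + 1)) = ζ := by simpa using hx
  have hfx : f.eval x ≠ 0 := by
    intro h
    rw [h, zero_pow] at hx'
    · exact hζ hx'.symm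
    · have : 0 < e := by omega
      positivity
  rw [mem_roots hG, IsRoot.def]
  have hxQ : x ^ (M * M) = x := by rw [← hK]; exact FiniteField.pow_card x
  have h1 : (G.eval x) ^ M * (f.eval x) ^ M = eval x (∑ k, C (c k) * w k) := by
    rw [eval_finsetSum, eval_finsetSum, hMp, sum_pow_char_pow, ← hMp, Finset.sum_mul]
    refine Finset.sum_congr rfl fun k _ => ?_
    have hcQ : (c k) ^ (M * M) = c k := by rw [← hK]; exact FiniteField.pow_card _
    simp only [w, eval_mul, eval_C, eval_pow, eval_X, mul_pow, ← pow_mul, hcQ]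
    have e1 : x ^ (((k.1 : ℕ) + M * k.2.2) * M) = x ^ ((k.1 : ℕ) * M + k.2.2) := by
      have : ((k.1 : ℕ) + M * k.2.2) * M = k.1 * M + (M * M) * k.2.2 := by ring
      rw [this, pow_add, pow_mul x (M * M), hxQ, ← pow_add]
    have e2 : eval x f ^ (e * (k.2.1 : ℕ) * M) * eval x f ^ M =
        ζ ^ (k.2.1 : ℕ) * eval x f ^ (M - e * k.2.1) := by
      rw [← hx', ← pow_mul, ← pow_add, ← pow_add]
      congr 1
      have := hie k.2.1
      obtain ⟨b, hb⟩ := Nat.exists_eq_add_of_le this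
      have hb2 : M - e * (k.2.1 : ℕ) = b := by omega
      rw [hb2]
      calc _ = e * (k.2.1 : ℕ) * M + M := rfl
        _ = e * (k.2.1 : ℕ) * M + (e * (k.2.1 : ℕ) + b) := by rw [← hb]
        _ = _ := by ring
    rw [e1, mul_assoc, mul_assoc, e2]
    ring
  rw [hc, eval_zero] at h1
  rcases mul_eq_zero.mp h1 with h | h
  · exact pow_eq_zero_iff (by omega) |>.mp h
  · exact absurd h (pow_ne_zero _ hfx)


lemma count_bound {K : Type*} [Field K] [Fintype K] [DecidableEq K] (p s : ℕ) [Fact p.Prime]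
    [CharP K p] (r e v M : ℕ) (hMp : M = p ^ s) (hK : Fintype.card K = M * M)
    (hM : M = r * e + 1) (hr : r.Prime)
    (hv : Nat.Coprime v r) (β : K) (u : K[X]) (hu : u.eval β ≠ 0) (f : K[X])
    (hf : f = (X - C β) ^ v * u) (ζ : K) (hζ : ζ ≠ 0) :
    r * (Finset.univ.filter fun x : K => (f.eval x) ^ (e * (M + 1)) = ζ).card
      ≤ M * M + r * (3 * r * f.natDegree + r * f.natDegree ^ 2 + 2 * f.natDegree + 5) * M := by
  have hr2 := hr.two_le
  have hu0 : u ≠ 0 := by rintro rfl; simp at hu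
  have hvd : v ≤ f.natDegree := by
    rw [hf, natDegree_mul (pow_ne_zero _ (X_sub_C_ne_zero β)) hu0, natDegree_pow,
      natDegree_X_sub_C]
    omega
  by_cases hev : e ≤ v
  · have h1 : (Finset.univ.filter fun x : K => (f.eval x) ^ (e * (M + 1)) = ζ).card ≤ M * M := by
      rw [← hK]; exact Finset.card_le_univ _
    have h2 : M ≤ r * f.natDegree + 1 := by
      rw [hM]; gcongr; omega
    have h3 : M * M ≤ (r * f.natDegree + 1) * M := Nat.mul_le_mul_right _ h2
    have h4 : (r * f.natDegree + 1) ≤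
      (3 * r * f.natDegree + r * f.natDegree ^ 2 + 2 * f.natDegree + 5) := by nlinarith [sq_nonneg f.natDegree]
    calc _ ≤ r * (M * M) := Nat.mul_le_mul_left _ h1
      _ ≤ r * ((3 * r * f.natDegree + r * f.natDegree ^ 2 + 2 * f.natDegree + 5) * M) :=
        Nat.mul_le_mul_left _ (h3.trans (Nat.mul_le_mul_right _ h4))
      _ ≤ _ := by rw [← mul_assoc]; omega
  · obtain ⟨A, hA⟩ : ∃ A, e = A + v := ⟨e - v, by omega⟩
    have hA1 : 1 ≤ A := by omega
    have hg : f.comp (X + C β) = X ^ v * u.comp (X + C β) := by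
      rw [hf]; simp
    have hgd : (f.comp (X + C β)).natDegree = f.natDegree := by
      rw [natDegree_comp, natDegree_X_add_C, mul_one]
    set d := f.natDegree with hd
    have hst := stepanov p s r e v A M (A + (2 * r * d + r * d ^ 2 + d + 3)) hMp hK hM hr hv hA.ge
      (u.comp (X + C β)) (by rw [coeff_zero_eq_eval_zero]; simpa using hu) _ hg (by
        rw [hgd, hM, hA]
        obtain ⟨B, rfl⟩ := Nat.exists_eq_add_of_le hA1
        obtain ⟨R, rfl⟩ := Nat.exists_eq_add_of_le hr2
        obtain ⟨D, hD⟩ := Nat.exists_eq_add_of_le hvd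
        rw [hD]
        nlinarith only [Nat.zero_le (B*R*v), Nat.zero_le (B*R*D), Nat.zero_le (B*R*v*v), Nat.zero_le (B*R*v*D), Nat.zero_le (B*R*D*D), Nat.zero_le (B*v), Nat.zero_le (B*D), Nat.zero_le (B * v * v), Nat.zero_le (B * v * D), Nat.zero_le (B * D * D), Nat.zero_le (R*R*D*D*B), Nat.zero_le (R*R*D*v*B), Nat.zero_le (R*R*v*v*B), Nat.zero_le (R*R*v*B), Nat.zero_le (R*R*D*B), Nat.zero_le (R*R*D*D), Nat.zero_le (R*R*D*v), Nat.zero_le (R*R*v*v), Nat.zero_le (R*R*v), Nat.zero_le (R*R*D), Nat.zero_le (R*D*D), Nat.zero_le (R*D*v), Nat.zero_le (R*v*v), Nat.zero_le (R*v), Nat.zero_le (R*D), Nat.zero_le (B*R), Nat.zero_le (D*D), Nat.zero_le (D*v), Nat.zero_le (v*v)]) ζ hζ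
    have hcard : (Finset.univ.filter fun x : K => (f.eval x) ^ (e * (M + 1)) = ζ).card =
        (Finset.univ.filter fun x : K =>
          ((f.comp (X + C β)).eval x) ^ (e * (M + 1)) = ζ).card := by
      symm
      apply Finset.card_bij (fun x _ => x + β)
      · intro x hx; simpa using hx
      · intro x _ y _ h; simpa using h
      · intro y hy; exact ⟨y - β, by simpa using hy, by simp⟩
    rw [hcard]
    rw [hgd] at hst
    have hAM : r * A ≤ M := by rw [hM, hA]; nlinarith
    calc _ ≤ r * (A + M * (A + (2 * r * d + r * d ^ 2 + d + 3)) + d * M) :=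
          Nat.mul_le_mul_left _ hst
      _ ≤ _ := by
        have h1 : r * A * M ≤ M * M := Nat.mul_le_mul_right _ hAM
        have h2 : 0 ≤ r * r * d * M := Nat.zero_le _
        have h3 : 0 ≤ r * M := Nat.zero_le _
        have h4 : M ≤ r * M := by nlinarith
        nlinarith

lemma charsum_split {K : Type*} [Field K] [Fintype K] [DecidableEq K] (r E : ℕ)
    (hr : r.Prime) (hE : Fintype.card K = r * E + 1) :
    ∃ γ : K, γ ≠ 0 ∧ (∀ ψ : MulChar K ℂ, ψ γ = 1 → ψ = 1) ∧
      ∀ (f : K → K) (ψ : MulChar K ℂ) , ψ ^ r = 1 → ∑ x, ψ (f x) = ∑ l ∈ Finset.range r,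
        ψ γ ^ l * (Finset.univ.filter fun x : K => (f x) ^ E = (γ ^ E) ^ l).card := by
  obtain ⟨g, hg⟩ := IsCyclic.exists_generator (α := Kˣ)
  have hEpos : 0 < E := by
    have := Fintype.one_lt_card (α := K)
    rcases Nat.eq_zero_or_pos E with h | h
    · subst h; omega
    · exact h
  have hord : orderOf g = r * E := by
    rw [orderOf_eq_card_of_forall_mem_zpowers hg, Nat.card_eq_fintype_card, Fintype.card_units, hE]
    simp
  have hordE : orderOf (g ^ E) = r := by
    rw [orderOf_pow_of_dvd hEpos.ne' (by rw [hord]; exact dvd_mul_left _ _), hord]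
    exact Nat.mul_div_cancel _ hEpos
  refine ⟨(g : K), g.ne_zero, ?_, ?_⟩
  · intro ψ h
    ext x
    obtain ⟨t, ht⟩ := (Submonoid.mem_powers_iff _ _).mp ((mem_powers_iff_mem_zpowers).mpr (hg x))
    rw [← ht]; simp [h]
  intro f ψ hψ
  have hψg : ψ g ^ r = 1 := by
    have := congrArg (fun χ : MulChar K ℂ => χ g) hψ
    simpa [MulChar.pow_apply_coe] using this
  have hpt : ∀ x, ψ (f x) = ∑ l ∈ Finset.range r,
      if (f x) ^ E = ((g : K) ^ E) ^ l then ψ g ^ l else 0 := by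
    intro x
    by_cases hx : f x = 0
    · rw [hx, MulChar.map_zero, Finset.sum_eq_zero]
      intro l _
      rw [if_neg]
      rw [zero_pow hEpos.ne']
      exact (pow_ne_zero _ (pow_ne_zero _ g.ne_zero)).symm
    · obtain ⟨t, ht⟩ := (Submonoid.mem_powers_iff _ _).mp
        ((mem_powers_iff_mem_zpowers).mpr (hg (Units.mk0 _ hx)))
      have hfx : f x = (g : K) ^ t := by
        have := congrArg Units.val ht
        simpa using this.symm
      have hcond : ∀ l, (f x) ^ E = ((g : K) ^ E) ^ l ↔ t ≡ l [MOD r] := by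
        intro l
        have h1 : (f x) ^ E = (((g ^ E) ^ t : Kˣ) : K) := by
          rw [hfx]; push_cast; rw [← pow_mul, ← pow_mul, mul_comm]
        have h2 : ((g : K) ^ E) ^ l = (((g ^ E) ^ l : Kˣ) : K) := by push_cast; rfl
        rw [h1, h2, Units.val_inj, pow_eq_pow_iff_modEq, hordE]
      rw [Finset.sum_eq_single (t % r)]
      · rw [if_pos ((hcond _).mpr (Nat.mod_modEq t r).symm), hfx, map_pow]
        conv_lhs => rw [← Nat.div_add_mod t r, pow_add, pow_mul, hψg, one_pow, one_mul]
      · intro l hl hne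
        rw [if_neg]
        intro h
        apply hne
        have := (hcond l).mp h
        rw [Nat.ModEq, Nat.mod_eq_of_lt (Finset.mem_range.mp hl)] at this
        exact this.symm
      · intro h
        exact absurd (Finset.mem_range.mpr (Nat.mod_lt _ hr.pos)) h
  simp_rw [hpt]
  rw [Finset.sum_comm]
  refine Finset.sum_congr rfl fun l _ => ?_
  rw [← Finset.sum_filter, Finset.sum_const, nsmul_eq_mul, mul_comm]

lemma charsum_bound (r d : ℕ) (hr : r.Prime) : ∃ B : ℝ, ∀ (K : Type) [Field K] [Fintype K]
    (p s : ℕ) [Fact p.Prime] [CharP K p] (M : ℕ), M = p ^ s → Fintype.card K = M * M →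
    r ∣ M - 1 → ∀ (v : ℕ) (_ : Nat.Coprime v r) (β : K) (u : K[X]) (_ : u.eval β ≠ 0) (f : K[X])
    (_ : f = (X - C β) ^ v * u) (_ : f.natDegree = d) (ψ : MulChar K ℂ), ψ ^ r = 1 → ψ ≠ 1 →
    ‖∑ x, ψ (f.eval x)‖ ≤ B * M := by
  classical
  refine ⟨r * (3 * r * d + r * d ^ 2 + 2 * d + 5) + d, ?_⟩
  intro K _ _ p s _ _ M hMp hK hrM v hv β u hu f hf hfd ψ hψ hψ1
  obtain ⟨e, he⟩ := hrM
  have hM1 : 1 ≤ M := by rw [hMp]; exact Nat.one_le_pow _ _ (Fact.out : p.Prime).pos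
  have hM : M = r * e + 1 := by omega
  have hE : Fintype.card K = r * (e * (M + 1)) + 1 := by
    rw [hK]
    have : M * M = (r * e + 1) * M := by rw [← hM]
    rw [this]
    have : r * e * M + M = r * e * M + (r * e + 1) := by rw [← hM]
    linarith
  obtain ⟨γ, hγ0, hγ, hsplit⟩ := charsum_split r (e * (M + 1)) hr hE
  have hcb := fun ζ hζ => count_bound p s r e v M hMp hK hM hr hv β u hu f hf ζ hζ
  rw [hfd] at hcb
  have hf0 : f ≠ 0 := by
    rw [hf]
    refine mul_ne_zero (pow_ne_zero _ (X_sub_C_ne_zero β)) ?_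
    rintro rfl; simp at hu
  set N : ℕ → ℕ := fun l => (Finset.univ.filter fun x : K =>
    (f.eval x) ^ (e * (M + 1)) = (γ ^ (e * (M + 1))) ^ l).card with hN
  have hS := hsplit (fun x => f.eval x) ψ hψ
  have hS1 := hsplit (fun x => f.eval x) 1 (one_pow _)
  have hω : ψ γ ^ r = 1 := by
    have := congrArg (fun χ : MulChar K ℂ => χ (Units.mk0 γ hγ0)) hψ
    simp only [MulChar.pow_apply_coe, MulChar.one_apply_coe] at this
    exact this
  have hω1 : ψ γ ≠ 1 := fun h => hψ1 (hγ ψ h)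
  have hnorm : ‖ψ γ‖ = 1 := Complex.norm_eq_one_of_pow_eq_one hω hr.ne_zero
  have hgeom : ∑ l ∈ Finset.range r, ψ γ ^ l = 0 := by
    have := geom_sum_mul (ψ γ) r
    rw [hω, sub_self] at this
    exact (mul_eq_zero.mp this).resolve_right (sub_ne_zero.mpr hω1)
  have hr0 : (0 : ℝ) < r := by exact_mod_cast hr.pos
  set T : ℝ := (M * M : ℝ) / r + (3 * r * d + r * d ^ 2 + 2 * d + 5) * M with hT
  have hNT : ∀ l, (N l : ℝ) ≤ T := by
    intro l
    have h := hcb ((γ ^ (e * (M + 1))) ^ l) (pow_ne_zero _ (pow_ne_zero _ hγ0))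
    have h' : (r : ℝ) * N l ≤ M * M + r * (3 * r * d + r * d ^ 2 + 2 * d + 5) * M := by
      exact_mod_cast h
    rw [hT, ← mul_le_mul_iff_right₀ hr0]
    refine h'.trans (le_of_eq ?_)
    field_simp
  have hNsum : (M * M : ℝ) - d ≤ ∑ l ∈ Finset.range r, (N l : ℝ) := by
    have h1 : (∑ x, (1 : MulChar K ℂ) (f.eval x)) =
        ((Finset.univ.filter fun x : K => f.eval x ≠ 0).card : ℂ) := by
      rw [Finset.card_filter, Nat.cast_sum]
      refine Finset.sum_congr rfl fun x _ => ?_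
      by_cases hx : f.eval x = 0
      · simp [hx, MulChar.map_zero]
      · simp [hx, MulChar.one_apply (isUnit_iff_ne_zero.mpr hx)]
    have h2 : ((Finset.univ.filter fun x : K => f.eval x ≠ 0).card : ℂ) =
        ∑ l ∈ Finset.range r, (N l : ℂ) := by
      rw [← h1, hS1]
      refine Finset.sum_congr rfl fun l _ => ?_
      rw [MulChar.one_apply (isUnit_iff_ne_zero.mpr hγ0), one_pow, one_mul]
    have h3 : (Finset.univ.filter fun x : K => f.eval x ≠ 0).card =
        ∑ l ∈ Finset.range r, N l := by exact_mod_cast h2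
    have h4 : (Finset.univ.filter fun x : K => f.eval x = 0).card ≤ d := by
      rw [← hfd]
      apply card_le_degree_of_subset_roots
      intro x hx
      rw [mem_roots hf0]
      simpa using hx
    have h5 := Finset.card_filter_add_card_filter_not (s := (Finset.univ : Finset K)) (fun x : K => f.eval x = 0)
    rw [Finset.card_univ, hK] at h5
    have h6 : M * M ≤ d + ∑ l ∈ Finset.range r, N l := by
      rw [← h3];
      have : (Finset.univ.filter fun x : K => f.eval x ≠ 0) = (Finset.univ.filter fun x : K => ¬ f.eval x = 0) := rfl
      rw [this]
      omega
    have h7 : (M * M : ℝ) ≤ d + ∑ l ∈ Finset.range r, (N l : ℝ) := by exact_mod_cast h6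
    linarith
  have hS2 : ∑ x, ψ (f.eval x) = - ∑ l ∈ Finset.range r, ψ γ ^ l * ((T - N l : ℝ) : ℂ) := by
    rw [hS]
    push_cast
    simp_rw [mul_sub]
    rw [Finset.sum_sub_distrib, ← Finset.sum_mul, hgeom]
    simp [N]
  rw [hS2, norm_neg]
  calc _ ≤ ∑ l ∈ Finset.range r, ‖ψ γ ^ l * ((T - N l : ℝ) : ℂ)‖ := norm_sum_le _ _
    _ = ∑ l ∈ Finset.range r, (T - N l) := by
      refine Finset.sum_congr rfl fun l _ => ?_
      rw [norm_mul, norm_pow, hnorm, one_pow, one_mul, Complex.norm_real, Real.norm_eq_abs,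
        abs_of_nonneg (sub_nonneg.mpr (hNT l))]
    _ = r * T - ∑ l ∈ Finset.range r, (N l : ℝ) := by
      rw [Finset.sum_sub_distrib]; simp
    _ ≤ r * T - (M * M - d) := by linarith
    _ = r * (3 * r * d + r * d ^ 2 + 2 * d + 5) * M + d := by
      rw [hT]; field_simp; ring
    _ ≤ _ := by
      have : (1 : ℝ) ≤ M := by exact_mod_cast hM1
      have : (0 : ℝ) ≤ d := by positivity
      nlinarith


lemma exists_enum {α : Type*} (D : ℕ) (s : Multiset α) (hs : Multiset.card s = D) :
    ∃ ω : Fin D → α, (Finset.univ : Finset (Fin D)).val.map ω = s := by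
  induction s using Quotient.inductionOn with
  | h l =>
    have hl : l.length = D := by simpa using hs
    subst hl
    refine ⟨l.get, ?_⟩
    rw [Fin.univ_val_map, List.ofFn_get]
    rfl

lemma newton_rec (D : ℕ) (ω : Fin D → ℂ) (n : ℕ) :
    (n : ℂ) * ((-1) ^ n * (Finset.univ.val.map ω).esymm n) =
      ∑ k ∈ Finset.range n, ((-1) ^ k * (Finset.univ.val.map ω).esymm k) *
        (- ∑ i, ω i ^ (n - k)) := by
  have h := congrArg (MvPolynomial.aeval ω) (MvPolynomial.mul_esymm_eq_sum (Fin D) ℂ n)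
  simp only [map_mul, map_natCast, map_pow, map_neg, map_one, map_sum,
    MvPolynomial.aeval_esymm_eq_multiset_esymm, MvPolynomial.psum, MvPolynomial.aeval_X] at h
  rw [Finset.sum_filter, Finset.Nat.sum_antidiagonal_eq_sum_range_succ_mk,
    Finset.sum_range_succ] at h
  simp only [lt_irrefl, if_false, add_zero] at h
  rw [mul_left_comm, h, ← mul_assoc, ← pow_add, Finset.mul_sum]
  refine Finset.sum_congr rfl fun k hk => ?_
  rw [if_pos (Finset.mem_range.mp hk)]
  have : (-1 : ℂ) ^ (n + (n + 1)) = -1 := by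
    rw [← add_assoc, ← two_mul, pow_succ, pow_mul]; simp
  rw [this]; ring

lemma newton_roots (D : ℕ) (c S : ℕ → ℂ) (hc0 : c 0 = 1) (hcD : ∀ n, D < n → c n = 0)
    (hrec : ∀ n : ℕ, (n : ℂ) * c n = ∑ k ∈ Finset.range n, c k * S (n - k)) :
    ∃ ω : Fin D → ℂ, ∀ k, 1 ≤ k → S k = - ∑ i, ω i ^ k := by
  let P : ℂ[X] := ∑ i ∈ Finset.range (D + 1), C (c i) * X ^ (D - i)
  have hcoef : ∀ j, j ≤ D → P.coeff (D - j) = c j := by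
    intro j hj
    simp only [P, finsetSum_coeff, coeff_C_mul_X_pow]
    rw [Finset.sum_eq_single_of_mem j (Finset.mem_range.mpr (by omega))]
    · simp
    · intro i hi hne
      rw [if_neg]
      have := Finset.mem_range.mp hi
      omega
  have hdegle : P.natDegree ≤ D := by
    refine natDegree_sum_le_of_forall_le _ _ fun i _ => ?_
    exact (natDegree_C_mul_X_pow_le _ _).trans (Nat.sub_le _ _)
  have hcD1 : P.coeff D = 1 := by have := hcoef 0 (Nat.zero_le _); rwa [Nat.sub_zero, hc0] at this
  have hdeg : P.natDegree = D := le_antisymm hdegle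
    (le_natDegree_of_ne_zero (by rw [hcD1]; exact one_ne_zero))
  have hlead : P.leadingCoeff = 1 := by rw [leadingCoeff, hdeg, hcD1]
  have hsplit : P.Splits := IsAlgClosed.splits P
  obtain ⟨ω, hω⟩ := exists_enum D P.roots (by rw [splits_iff_card_roots.mp hsplit, hdeg])
  have hce : ∀ n, c n = (-1) ^ n * (Finset.univ.val.map ω).esymm n := by
    intro n
    rcases le_or_gt n D with h | h
    · rw [← hcoef n h, coeff_eq_esymm_roots_of_splits hsplit (by rw [hdeg]; omega), hlead, hdeg, hω,
        one_mul]
      congr <;> omega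
    · rw [hcD n h, Multiset.esymm, Multiset.powersetCard_eq_empty]
      · simp
      · simpa using h
  refine ⟨ω, ?_⟩
  intro k
  induction k using Nat.strong_induction_on with
  | _ k ih =>
    intro hk
    obtain ⟨n, rfl⟩ : ∃ n, k = n + 1 := ⟨k - 1, by omega⟩
    have h1 := hrec (n + 1)
    have h2 := newton_rec D ω (n + 1)
    simp_rw [← hce] at h2
    rw [h1, Finset.sum_range_succ', Finset.sum_range_succ', hc0] at h2
    have h3 : ∑ k ∈ Finset.range n, c (k + 1) * S (n + 1 - (k + 1)) =
        ∑ k ∈ Finset.range n, c (k + 1) * -∑ i, ω i ^ (n + 1 - (k + 1)) := by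
      refine Finset.sum_congr rfl fun k hk => ?_
      have := Finset.mem_range.mp hk
      rw [ih _ (by omega) (by omega)]
    rw [h3] at h2
    simpa using h2

lemma powsum_bound_aux (D : ℕ) (z : Fin D → ℂ) (C b : ℝ) (hb : 0 < b)
    (h : ∀ k, 1 ≤ k → ‖∑ i, z i ^ k‖ ≤ C * b ^ k) (i : Fin D) : ‖z i‖ ≤ b := by
  classical
  let g : ℂ[X] := ∏ w ∈ (Finset.univ.image z).erase (z i), (X - Polynomial.C w)
  have hgi : g.eval (z i) ≠ 0 := by
    simp only [g, eval_prod, eval_sub, eval_X, eval_C]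
    refine Finset.prod_ne_zero_iff.mpr fun w hw => ?_
    exact sub_ne_zero.mpr (Finset.ne_of_mem_erase hw).symm
  have hg0 : ∀ j, z j ≠ z i → g.eval (z j) = 0 := by
    intro j hj
    simp only [g, eval_prod, eval_sub, eval_X, eval_C]
    refine Finset.prod_eq_zero (i := z j) ?_ (sub_self _)
    exact Finset.mem_erase.mpr ⟨hj, Finset.mem_image_of_mem _ (Finset.mem_univ _)⟩
  let m := (Finset.univ.filter fun j => z j = z i).card
  have hm : 1 ≤ m := Finset.card_pos.mpr ⟨i, by simp⟩
  have hid : ∀ k, (m : ℂ) * (g.eval (z i) * z i ^ k) =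
      ∑ t ∈ Finset.range (g.natDegree + 1), g.coeff t * ∑ j, z j ^ (k + t) := by
    intro k
    have h1 : ∑ j, g.eval (z j) * z j ^ k = (m : ℂ) * (g.eval (z i) * z i ^ k) := by
      rw [← Finset.sum_filter_add_sum_filter_not Finset.univ (fun j => z j = z i)]
      rw [Finset.sum_eq_zero (s := Finset.univ.filter fun j => ¬ z j = z i), add_zero]
      · rw [Finset.sum_congr rfl (g := fun _ => g.eval (z i) * z i ^ k)]
        · rw [Finset.sum_const, nsmul_eq_mul]
        · intro j hj
          rw [(Finset.mem_filter.mp hj).2]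
      · intro j hj
        rw [hg0 j (Finset.mem_filter.mp hj).2, zero_mul]
    rw [← h1]
    simp_rw [eval_eq_sum_range, Finset.sum_mul, Finset.mul_sum]
    rw [Finset.sum_comm]
    refine Finset.sum_congr rfl fun t _ => Finset.sum_congr rfl fun j _ => ?_
    rw [pow_add]; ring
  by_contra hlt
  push Not at hlt
  let C' : ℝ := ∑ t ∈ Finset.range (g.natDegree + 1), ‖g.coeff t‖ * (C * b ^ t)
  have hbd : ∀ k, 1 ≤ k → ‖g.eval (z i)‖ * ‖z i‖ ^ k ≤ C' * b ^ k := by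
    intro k hk
    have h2 : ‖(m : ℂ) * (g.eval (z i) * z i ^ k)‖ ≤ C' * b ^ k := by
      rw [hid, Finset.sum_mul]
      refine (norm_sum_le _ _).trans (Finset.sum_le_sum fun t _ => ?_)
      rw [norm_mul, mul_assoc]
      refine mul_le_mul_of_nonneg_left ?_ (norm_nonneg _)
      refine (h (k + t) (by omega)).trans (le_of_eq ?_)
      rw [pow_add]; ring
    rw [norm_mul, norm_mul, norm_pow, Complex.norm_natCast] at h2
    refine le_trans ?_ h2
    have : (1 : ℝ) ≤ m := by exact_mod_cast hm
    have h3 : 0 ≤ ‖g.eval (z i)‖ * ‖z i‖ ^ k := by positivity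
    nlinarith
  have hratio : 1 < ‖z i‖ / b := (one_lt_div hb).mpr hlt
  have hgpos : 0 < ‖g.eval (z i)‖ := norm_pos_iff.mpr hgi
  obtain ⟨n, hn⟩ := pow_unbounded_of_one_lt (C' / ‖g.eval (z i)‖) hratio
  have hn1 : C' / ‖g.eval (z i)‖ < (‖z i‖ / b) ^ (n + 1) :=
    hn.trans_le (pow_le_pow_right₀ hratio.le (Nat.le_succ n))
  have h4 := hbd (n + 1) (by omega)
  rw [div_pow, div_lt_div_iff₀ hgpos (by positivity)] at hn1
  linarith

lemma powsum_bound (D k0 : ℕ) (hk0 : 1 ≤ k0) (z : Fin D → ℂ) (C b : ℝ) (hb : 0 < b)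
    (h : ∀ k, 1 ≤ k → ‖∑ i, z i ^ (k0 * k)‖ ≤ C * b ^ (k0 * k)) (i : Fin D) : ‖z i‖ ≤ b := by
  have := powsum_bound_aux D (fun i => z i ^ k0) C (b ^ k0) (by positivity) (by
    intro k hk
    simp_rw [← pow_mul]
    exact h k hk) i
  rw [norm_pow] at this
  exact (pow_le_pow_iff_left₀ (norm_nonneg _) hb.le (by omega)).mp this


section LF
variable {F : Type*} [Field F] [Fintype F]

lemma finite_monics (n : ℕ) : {h : F[X] | h.Monic ∧ h.natDegree = n}.Finite := by
  have : Set.InjOn (fun (h : F[X]) (i : Fin n) => h.coeff i) {h : F[X] | h.Monic ∧ h.natDegree = n} := by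
    intro g hg h hh hgh
    ext i
    rcases lt_trichotomy i n with hi | hi | hi
    · exact congrFun hgh ⟨i, hi⟩
    · have h1 := hg.1.coeff_natDegree
      have h2 := hh.1.coeff_natDegree
      rw [hg.2] at h1
      rw [hh.2] at h2
      rw [hi, h1, h2]
    · rw [coeff_eq_zero_of_natDegree_lt (by rw [hg.2]; exact hi),
        coeff_eq_zero_of_natDegree_lt (by rw [hh.2]; exact hi)]
  exact Set.Finite.of_finite_image (Set.toFinite _) this

noncomputable def monics (F : Type*) [Field F] [Fintype F] (n : ℕ) : Finset F[X] :=
  (finite_monics (F := F) n).toFinset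

lemma mem_monics {n : ℕ} {h : F[X]} : h ∈ monics F n ↔ h.Monic ∧ h.natDegree = n := by
  simp [monics]

open Classical in
noncomputable def irrs (F : Type*) [Field F] [Fintype F] (n : ℕ) : Finset F[X] :=
  (monics F n).filter Irreducible

lemma mem_irrs {n : ℕ} {h : F[X]} :
    h ∈ irrs F n ↔ h.Monic ∧ h.natDegree = n ∧ Irreducible h := by
  simp [irrs, mem_monics, and_assoc]

noncomputable def cc (Xf : F[X] → ℂ) (n : ℕ) : ℂ := ∑ h ∈ monics F n, Xf h

noncomputable def SS (Xf : F[X] → ℂ) (k : ℕ) : ℂ :=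
  ∑ x ∈ k.divisorsAntidiagonal, ∑ P ∈ irrs F x.1, (x.1 : ℂ) * Xf P ^ x.2

lemma sum_antidiag_eq (n : ℕ) (g : ℕ → ℕ → ℕ) (hg : ∀ d m, n < d * m → g d m = 0) :
    ∑ k ∈ Finset.Icc 1 n, ∑ x ∈ k.divisorsAntidiagonal, g x.1 x.2 =
    ∑ d ∈ Finset.Icc 1 n, ∑ m ∈ Finset.Icc 1 n, g d m := by
  rw [← Finset.sum_product']
  have h1 : ∑ x ∈ Finset.Icc 1 n ×ˢ Finset.Icc 1 n, g x.1 x.2 =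
      ∑ x ∈ (Finset.Icc 1 n ×ˢ Finset.Icc 1 n).filter (fun x => x.1 * x.2 ≤ n), g x.1 x.2 := by
    rw [Finset.sum_filter]
    refine Finset.sum_congr rfl fun x _ => ?_
    split_ifs with h
    · rfl
    · exact hg _ _ (by omega)
  rw [h1]
  rw [← Finset.sum_fiberwise_of_maps_to (s := (Finset.Icc 1 n ×ˢ Finset.Icc 1 n).filter
    (fun x => x.1 * x.2 ≤ n)) (t := Finset.Icc 1 n) (g := fun x => x.1 * x.2)]
  · refine Finset.sum_congr rfl fun k hk => ?_
    refine Finset.sum_congr ?_ fun _ _ => rfl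
    ext ⟨a, b⟩
    simp only [Finset.mem_filter, Finset.mem_product, Finset.mem_Icc, Nat.mem_divisorsAntidiagonal] at hk ⊢
    constructor
    · rintro ⟨rfl, h0⟩
      have ha : 1 ≤ a := Nat.pos_of_ne_zero (left_ne_zero_of_mul h0)
      have hb : 1 ≤ b := Nat.pos_of_ne_zero (right_ne_zero_of_mul h0)
      exact ⟨⟨⟨⟨ha, by nlinarith⟩, hb, by nlinarith⟩, hk.2⟩, rfl⟩
    · rintro ⟨_, rfl⟩
      exact ⟨rfl, by omega⟩
  · rintro ⟨a, b⟩ hx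
    simp only [Finset.mem_filter, Finset.mem_product, Finset.mem_Icc] at hx ⊢
    exact ⟨Nat.mul_pos hx.1.1.1 hx.1.2.1, hx.2⟩

open Classical in
lemma degree_count (n : ℕ) (h : F[X]) (hh : h ∈ monics F n) :
    n = ∑ k ∈ Finset.Icc 1 n, ∑ x ∈ k.divisorsAntidiagonal, ∑ P ∈ irrs F x.1,
      if P ^ x.2 ∣ h then x.1 else 0 := by
  obtain ⟨hmon, hdeg⟩ := mem_monics.mp hh
  rw [sum_antidiag_eq n (fun d m => ∑ P ∈ irrs F d, if P ^ m ∣ h then d else 0)]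
  swap
  · intro d m hdm
    refine Finset.sum_eq_zero fun P hP => ?_
    rw [if_neg]
    intro hdvd
    obtain ⟨hP1, hP2, hP3⟩ := mem_irrs.mp hP
    have := natDegree_le_of_dvd hdvd hmon.ne_zero
    rw [hP1.natDegree_pow, hP2, hdeg, mul_comm] at this
    omega
  let s := UniqueFactorizationMonoid.normalizedFactors h
  have hs_monic : ∀ P ∈ s, P.Monic ∧ Irreducible P := by
    intro P hP
    have hirr := UniqueFactorizationMonoid.irreducible_of_normalized_factor P hP
    have hnorm := UniqueFactorizationMonoid.normalize_normalized_factor P hP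
    exact ⟨by rw [← hnorm]; exact monic_normalize hirr.ne_zero, hirr⟩
  have hprod : s.prod = h := by
    have h1 := UniqueFactorizationMonoid.prod_normalizedFactors hmon.ne_zero
    have h2 : s.prod.Monic := by
      simpa using monic_multiset_prod_of_monic s id (fun P hP => (hs_monic P hP).1)
    exact eq_of_monic_of_associated h2 hmon h1
  have hdegsum : n = ∑ P ∈ s.toFinset, s.count P * P.natDegree := by
    rw [← hdeg]
    conv_lhs => rw [← hprod]
    rw [natDegree_multiset_prod_of_monic s (fun P hP => (hs_monic P hP).1),
      Finset.sum_multiset_map_count]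
    simp
  have hcount : ∀ d, ∀ P ∈ irrs F d, ∑ m ∈ Finset.Icc 1 n, (if P ^ m ∣ h then d else 0) =
      s.count P * d := by
    intro d P hP
    obtain ⟨hP1, hP2, hP3⟩ := mem_irrs.mp hP
    have hd : 1 ≤ d := by rw [← hP2]; exact hP3.natDegree_pos
    have hdv : ∀ m, P ^ m ∣ h ↔ m ≤ s.count P := by
      intro m
      rw [pow_dvd_iff_le_emultiplicity,
        UniqueFactorizationMonoid.emultiplicity_eq_count_normalizedFactors hP3 hmon.ne_zero,
        hP1.normalize_eq_self]
      exact Nat.cast_le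
    have hle : s.count P ≤ n := by
      have h1 := natDegree_le_of_dvd ((hdv _).mpr le_rfl) hmon.ne_zero
      rw [hP1.natDegree_pow, hP2, hdeg] at h1
      nlinarith
    simp_rw [hdv]
    rw [← Finset.sum_filter, Finset.sum_const, smul_eq_mul]
    congr 1
    have : (Finset.Icc 1 n).filter (fun m => m ≤ s.count P) = Finset.Icc 1 (s.count P) := by
      ext m; simp only [Finset.mem_filter, Finset.mem_Icc]; omega
    rw [this]; simp
  conv_lhs => rw [hdegsum]
  rw [← Finset.sum_fiberwise_of_maps_to (s := s.toFinset) (t := Finset.Icc 1 n)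
    (g := fun P => P.natDegree)]
  · refine Finset.sum_congr rfl fun d _ => ?_
    rw [Finset.sum_comm, Finset.sum_congr rfl (hcount d)]
    rw [← Finset.sum_subset (s₁ := s.toFinset.filter fun P => P.natDegree = d) (s₂ := irrs F d)]
    · refine Finset.sum_congr rfl fun P hP => ?_
      rw [(Finset.mem_filter.mp hP).2]
    · intro P hP
      obtain ⟨h1, h2⟩ := Finset.mem_filter.mp hP
      have := hs_monic P (Multiset.mem_toFinset.mp h1)
      exact mem_irrs.mpr ⟨this.1, h2, this.2⟩
    · intro P hP hP'
      have : P ∉ s := by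
        intro h1
        exact hP' (Finset.mem_filter.mpr ⟨Multiset.mem_toFinset.mpr h1, (mem_irrs.mp hP).2.1⟩)
      rw [Multiset.count_eq_zero_of_notMem this, zero_mul]
  · intro P hP
    have hP' := Multiset.mem_toFinset.mp hP
    have h1 := hs_monic P hP'
    refine Finset.mem_Icc.mpr ⟨h1.2.natDegree_pos, ?_⟩
    rw [← hdeg]
    exact natDegree_le_of_dvd (UniqueFactorizationMonoid.dvd_of_mem_normalizedFactors hP')
      hmon.ne_zero

open Classical in
lemma sum_dvd (Xf : F[X] → ℂ)
    (hmul : ∀ g h : F[X], g.Monic → h.Monic → Xf (g * h) = Xf g * Xf h)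
    (hone : Xf 1 = 1) (n m d : ℕ) (P : F[X]) (hP : P ∈ monics F d) (hn : d * m ≤ n) :
    ∑ h ∈ monics F n, (if P ^ m ∣ h then Xf h else 0) = Xf P ^ m * cc Xf (n - d * m) := by
  obtain ⟨hP1, hP2⟩ := mem_monics.mp hP
  have hpow : ∀ m, Xf (P ^ m) = Xf P ^ m := by
    intro m
    induction m with
    | zero => simp [hone]
    | succ m ih => rw [pow_succ, pow_succ, hmul _ _ (hP1.pow m) hP1, ih]
  rw [← Finset.sum_filter, cc, Finset.mul_sum]
  symm
  apply Finset.sum_bij (fun h _ => P ^ m * h)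
  · intro h hh
    obtain ⟨h1, h2⟩ := mem_monics.mp hh
    refine Finset.mem_filter.mpr ⟨mem_monics.mpr ⟨(hP1.pow m).mul h1, ?_⟩, dvd_mul_right _ _⟩
    rw [(hP1.pow m).natDegree_mul h1, hP1.natDegree_pow, hP2, h2, mul_comm]
    omega
  · intro a _ b _ hab
    exact mul_left_cancel₀ (hP1.pow m).ne_zero hab
  · intro b hb
    obtain ⟨h1, ⟨g, rfl⟩⟩ := Finset.mem_filter.mp hb
    obtain ⟨h2, h3⟩ := mem_monics.mp h1
    have hg : g.Monic := (hP1.pow m).of_mul_monic_left h2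
    refine ⟨g, mem_monics.mpr ⟨hg, ?_⟩, rfl⟩
    rw [(hP1.pow m).natDegree_mul hg, hP1.natDegree_pow, hP2, mul_comm] at h3
    omega
  · intro h hh
    rw [hmul _ _ (hP1.pow m) (mem_monics.mp hh).1, hpow]

lemma cc_rec (Xf : F[X] → ℂ)
    (hmul : ∀ g h : F[X], g.Monic → h.Monic → Xf (g * h) = Xf g * Xf h)
    (hone : Xf 1 = 1) (n : ℕ) :
    (n : ℂ) * cc Xf n = ∑ k ∈ Finset.range n, cc Xf k * SS Xf (n - k) := by
  classical
  have h1 : (n : ℂ) * cc Xf n = ∑ h ∈ monics F n, ∑ k ∈ Finset.Icc 1 n,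
      ∑ x ∈ k.divisorsAntidiagonal, ∑ P ∈ irrs F x.1,
        (x.1 : ℂ) * (if P ^ x.2 ∣ h then Xf h else 0) := by
    rw [cc, Finset.mul_sum]
    refine Finset.sum_congr rfl fun h hh => ?_
    have h2 := congrArg (fun t : ℕ => (t : ℂ)) (degree_count n h hh)
    have h2' : (n : ℂ) * Xf h = _ * Xf h := congrArg (· * Xf h) h2
    rw [h2']
    push_cast
    simp_rw [Finset.sum_mul]
    refine Finset.sum_congr rfl fun k _ => Finset.sum_congr rfl fun x _ =>
      Finset.sum_congr rfl fun P _ => ?_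
    split_ifs <;> simp
  rw [h1, Finset.sum_comm]
  have h3 : ∀ k ∈ Finset.Icc 1 n, ∑ h ∈ monics F n,
      ∑ x ∈ k.divisorsAntidiagonal, ∑ P ∈ irrs F x.1,
        (x.1 : ℂ) * (if P ^ x.2 ∣ h then Xf h else 0) = cc Xf (n - k) * SS Xf k := by
    intro k hk
    rw [Finset.sum_comm, SS, Finset.mul_sum]
    refine Finset.sum_congr rfl fun x hx => ?_
    rw [Finset.sum_comm, Finset.mul_sum]
    refine Finset.sum_congr rfl fun P hP => ?_
    obtain ⟨hP1, hP2, hP3⟩ := mem_irrs.mp hP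
    have hx' := (Nat.mem_divisorsAntidiagonal.mp hx).1
    rw [← Finset.mul_sum, sum_dvd Xf hmul hone n x.2 x.1 P (mem_monics.mpr ⟨hP1, hP2⟩)
      (by rw [hx']; exact (Finset.mem_Icc.mp hk).2), hx']
    ring
  rw [Finset.sum_congr rfl h3]
  apply Finset.sum_bij' (fun k _ => n - k) (fun k _ => n - k)
  · intro k hk; simp only [Finset.mem_Icc, Finset.mem_range] at hk ⊢; omega
  · intro k hk; simp only [Finset.mem_Icc, Finset.mem_range] at hk ⊢; omega
  · intro k hk; simp only [Finset.mem_Icc] at hk; omega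
  · intro k hk; simp only [Finset.mem_range] at hk; omega
  · intro k hk
    simp only [Finset.mem_Icc] at hk
    have : n - (n - k) = k := by omega
    rw [this]

end LF


lemma norm_resultant_pb {F S : Type*} [Field F] [Field S] [Algebra F S] [FiniteDimensional F S]
    [Algebra.IsSeparable F S] (pb : PowerBasis F S) (g : F[X]) :
    Algebra.norm F (aeval pb.gen g) = resultant (minpoly F pb.gen) g := by
  classical
  let E := AlgebraicClosure F
  apply (algebraMap F E).injective
  have hmon := minpoly.monic pb.isIntegral_gen
  rw [Algebra.norm_eq_prod_embeddings F E, ← resultant_map_map,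
    ← natDegree_map_eq_of_injective (algebraMap F E).injective (minpoly F pb.gen),
    resultant_eq_prod_eval _ _ _ (natDegree_map_le) (IsAlgClosed.splits _),
    (hmon.map _).leadingCoeff, one_pow, one_mul]
  have hnd : ((minpoly F pb.gen).map (algebraMap F E)).roots.Nodup :=
    nodup_roots (Separable.map (show (minpoly F pb.gen).Separable from Algebra.IsSeparable.isSeparable F pb.gen))
  have h1 : (Multiset.map (fun x => eval x (g.map (algebraMap F E))) ((minpoly F pb.gen).map (algebraMap F E)).roots).prod
      = ∏ y ∈ ((minpoly F pb.gen).map (algebraMap F E)).roots.toFinset, aeval y g := by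
    rw [Finset.prod_eq_multiset_prod, Multiset.toFinset_val, hnd.dedup]
    simp [eval_map_algebraMap]
  rw [h1]
  apply Finset.prod_bij (fun (σ : S →ₐ[F] E) _ => σ pb.gen)
  · intro σ _
    rw [Multiset.mem_toFinset, mem_roots (hmon.map _).ne_zero, IsRoot.def, eval_map_algebraMap,
      aeval_algHom_apply, minpoly.aeval, map_zero]
  · intro σ _ τ _ h
    exact pb.algHom_ext h
  · intro y hy
    rw [Multiset.mem_toFinset, mem_roots (hmon.map _).ne_zero, IsRoot.def, eval_map_algebraMap] at hy
    exact ⟨pb.lift y hy, Finset.mem_univ _, pb.lift_gen _ _⟩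
  · intro σ _
    rw [aeval_algHom_apply]

open IntermediateField in
lemma norm_resultant {F K : Type*} [Field F] [Field K] [Algebra F K] [FiniteDimensional F K]
    [Algebra.IsSeparable F K] (x : K) (g : F[X]) (m : ℕ)
    (hm : (minpoly F x).natDegree * m = Module.finrank F K) :
    Algebra.norm F (aeval x g) = resultant (minpoly F x) g ^ m := by
  have hx : IsIntegral F x := Algebra.IsIntegral.isIntegral x
  let pb := adjoin.powerBasis hx
  have hgen : pb.gen = AdjoinSimple.gen F x := adjoin.powerBasis_gen hx
  have h1 : aeval x g = algebraMap F⟮x⟯ K (aeval pb.gen g) := by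
    rw [← aeval_algebraMap_apply, hgen, AdjoinSimple.algebraMap_gen]
  have h2 : minpoly F pb.gen = minpoly F x := by
    rw [hgen, minpoly_gen]
  have h3 : Module.finrank F⟮x⟯ K = m := by
    have h4 := Module.finrank_mul_finrank F F⟮x⟯ K
    rw [adjoin.finrank hx, ← hm] at h4
    exact Nat.eq_of_mul_eq_mul_left (minpoly.natDegree_pos hx) h4
  rw [h1, ← Algebra.norm_norm (R := F) (S := F⟮x⟯), Algebra.norm_algebraMap, map_pow, h3,
    norm_resultant_pb, h2]

lemma card_roots_irr {F K : Type*} [Field F] [Field K] [Algebra F K] [Finite K]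
    [Finite F] (P : F[X]) (hP : Irreducible P)  (hmon : P.Monic)
    (hd : P.natDegree ∣ Module.finrank F K) :
    Nat.card {x : K // aeval x P = 0} = P.natDegree := by
  have : Fact (Irreducible P) := ⟨hP⟩
  let pb := AdjoinRoot.powerBasis hP.ne_zero
  have hfr : Module.finrank F (AdjoinRoot P) = P.natDegree := by
    rw [pb.finrank]; rfl
  have h := FiniteField.natCard_algHom_of_finrank_dvd (F := F) (K := AdjoinRoot P) (L := K) (hfr ▸ hd)
  rw [hfr] at h
  have hmp : minpoly F pb.gen = P := by
    rw [AdjoinRoot.minpoly_powerBasis_gen_of_monic hmon]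
  rw [← h, Nat.card_congr (pb.liftEquiv (S' := K)), hmp]


noncomputable def XX {F : Type*} [Field F] (χ : MulChar F ℂ) (f : F[X]) (h : F[X]) : ℂ :=
  χ (resultant h f)

lemma SS_eq {F K : Type*} [Field F] [Fintype F] [Field K] [Fintype K] [Algebra F K]
    (χ : MulChar F ℂ) (f : F[X]) (n : ℕ) (hn : Module.finrank F K = n) :
    SS (XX χ f) n = ∑ x : K, χ (Algebra.norm F (aeval x f)) := by
  classical
  have hdvd : ∀ x : K, (minpoly F x).natDegree ∣ n := fun x => by
    rw [← hn]; exact minpoly.degree_dvd (Algebra.IsIntegral.isIntegral x)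
  have hn0 : n ≠ 0 := by rw [← hn]; exact Module.finrank_pos.ne'
  rw [SS, ← Finset.sum_fiberwise_of_maps_to (s := Finset.univ) (t := n.divisorsAntidiagonal)
    (g := fun x : K => ((minpoly F x).natDegree, n / (minpoly F x).natDegree))]
  swap
  · intro x _
    exact Nat.mem_divisorsAntidiagonal.mpr ⟨Nat.mul_div_cancel' (hdvd x), hn0⟩
  refine Finset.sum_congr rfl fun y hy => ?_
  obtain ⟨d, m⟩ := y
  obtain ⟨hdm, _⟩ := Nat.mem_divisorsAntidiagonal.mp hy
  simp only at hdm ⊢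
  have hd0 : 0 < d := Nat.pos_of_ne_zero (by rintro rfl; simp at hdm; omega)
  rw [← Finset.sum_fiberwise_of_maps_to (t := irrs F d) (g := fun x : K => minpoly F x)]
  swap
  · intro x hx
    have hi : IsIntegral F x := Algebra.IsIntegral.isIntegral x
    have := (Finset.mem_filter.mp hx).2
    exact mem_irrs.mpr ⟨minpoly.monic hi, congrArg Prod.fst this, minpoly.irreducible hi⟩
  refine Finset.sum_congr rfl fun P hP => ?_
  obtain ⟨hP1, hP2, hP3⟩ := mem_irrs.mp hP
  rw [Finset.sum_congr rfl (g := fun _ => XX χ f P ^ m), Finset.sum_const, nsmul_eq_mul]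
  · congr 2
    have h1 := card_roots_irr (K := K) P hP3 hP1 (by rw [hP2, hn, ← hdm]; exact dvd_mul_right _ _)
    rw [hP2] at h1
    refine h1.symm.trans ?_
    rw [Nat.card_eq_fintype_card, Fintype.card_subtype]
    congr 1
    ext x
    simp only [Finset.mem_filter, Finset.mem_univ, true_and]
    constructor
    · intro hx
      have : P = minpoly F x := minpoly.eq_of_irreducible_of_monic hP3 hx hP1
      rw [← this, hP2, ← hdm, Nat.mul_div_cancel_left _ hd0]
      simp
    · rintro ⟨_, h⟩
      rw [← h, minpoly.aeval]
  · intro x hx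
    have hx2 := (Finset.mem_filter.mp hx).2
    rw [norm_resultant x f m (by rw [hx2, hP2, hdm, hn]), hx2, XX, map_pow]

lemma XX_mul {F : Type*} [Field F] (χ : MulChar F ℂ) (f : F[X]) (g h : F[X])
    (hg : g.Monic) (hh : h.Monic) : XX χ f (g * h) = XX χ f g * XX χ f h := by
  rw [XX, XX, XX, hg.natDegree_mul hh, resultant_mul_left _ _ _ _ le_rfl, map_mul]

lemma XX_one {F : Type*} [Field F] (χ : MulChar F ℂ) (f : F[X]) :
    XX χ f 1 = 1 := by
  simp [XX]

lemma cc_zero {F : Type*} [Field F] [Fintype F] (χ : MulChar F ℂ) (f : F[X]) :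
    cc (XX χ f) 0 = 1 := by
  have : monics F 0 = {1} := by
    ext h
    rw [mem_monics, Finset.mem_singleton]
    constructor
    · rintro ⟨h1, h2⟩; exact h1.natDegree_eq_zero.mp h2
    · rintro rfl; simp
  rw [cc, this, Finset.sum_singleton, XX_one χ f]


section VAN
variable {F : Type*} [Field F] [Fintype F]

lemma res_eq_norm (p : F[X]) (hp : p.Monic) [Fact (Irreducible p)] (h : F[X]) :
    resultant p h = Algebra.norm F (AdjoinRoot.mk p h) := by
  have hirr : Irreducible p := Fact.out
  let pb := AdjoinRoot.powerBasis hirr.ne_zero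
  have : FiniteDimensional F (AdjoinRoot p) := pb.finite
  have h1 := norm_resultant_pb pb h
  have hmp : minpoly F pb.gen = p := AdjoinRoot.minpoly_powerBasis_gen_of_monic hp
  rw [hmp] at h1
  rw [← h1]
  congr 1
  rw [AdjoinRoot.powerBasis_gen, AdjoinRoot.aeval_eq]

lemma res_congr (p : F[X]) (hp : p.Monic) (hirr : Irreducible p) {a b : F[X]} (h : p ∣ a - b) :
    resultant p a = resultant p b := by
  have : Fact (Irreducible p) := ⟨hirr⟩
  rw [res_eq_norm p hp, res_eq_norm p hp, AdjoinRoot.mk_eq_mk.mpr h]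

lemma res_mul (p : F[X]) (hp : p.Monic) (hirr : Irreducible p) (a b : F[X]) :
    resultant p (a * b) = resultant p a * resultant p b := by
  have : Fact (Irreducible p) := ⟨hirr⟩
  rw [res_eq_norm p hp, res_eq_norm p hp, res_eq_norm p hp, map_mul, map_mul]

lemma res_surj (p : F[X]) (hp : p.Monic) (hirr : Irreducible p) (y : F) :
    ∃ w, resultant p w = y := by
  have : Fact (Irreducible p) := ⟨hirr⟩
  have hfd : FiniteDimensional F (AdjoinRoot p) := (AdjoinRoot.powerBasis hirr.ne_zero).finite
  have : Finite (AdjoinRoot p) := Module.finite_of_finite F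
  obtain ⟨z, hz⟩ := FiniteField.norm_surjective F (AdjoinRoot p) y
  obtain ⟨w, rfl⟩ := AdjoinRoot.mk_surjective z
  exact ⟨w, by rw [res_eq_norm p hp, hz]⟩

lemma res_coprime (p : F[X]) (hp : p.Monic) (hirr : Irreducible p) (u : F[X])
    (h : resultant p u ≠ 0) : IsCoprime u p := by
  rw [isCoprime_comm]
  refine (EuclideanDomain.dvd_or_coprime p u hirr).resolve_left fun hd => h ?_
  rw [res_congr p hp hirr (b := 0) (by simpa using hd)]
  simp [hirr.natDegree_pos.ne']

lemma res_flip {L : ℕ} (p : Fin L → F[X]) (hmon : ∀ i, (p i).Monic)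
    (v : Fin L → ℕ) (h : F[X]) : resultant h (∏ i, p i ^ v i) =
    (-1) ^ (h.natDegree * (∏ i, p i ^ v i).natDegree) * ∏ i, resultant (p i) h ^ v i := by
  rw [resultant_comm, resultant_prod_left _ _ _ _ _ le_rfl]
  · congr 1
    refine Finset.prod_congr rfl fun i _ => ?_
    exact resultant_pow_left _ _ _ _ (by simp [(hmon i).leadingCoeff]) le_rfl
  · rw [Finset.prod_congr rfl fun i _ => ((hmon i).pow (v i)).leadingCoeff]
    simp

lemma shift_sum (R u : F[X]) (hR : R.Monic) (hu : IsCoprime u R) (n : ℕ) (hn : R.natDegree ≤ n)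
    (hR0 : R ≠ 1) (G : F[X] → ℂ) (c : ℂ)
    (hG : ∀ h h', R ∣ h' - u * h → G h' = c * G h) (hc : c ≠ 1) : ∑ h ∈ monics F n, G h = 0 := by
  have hRdeg : 0 < R.natDegree := Nat.pos_of_ne_zero fun h => hR0 (hR.natDegree_eq_zero.mp h)
  let T : F[X] → F[X] := fun h => R * (h /ₘ R) + (u * h) %ₘ R
  have hT1 : ∀ h, R ∣ T h - u * h := by
    intro h
    have h1 := modByMonic_add_div (u * h) R
    refine ⟨h /ₘ R - (u * h) /ₘ R, ?_⟩
    simp only [T]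
    linear_combination h1
  have hlow : ∀ g : F[X], ∀ h : F[X], h.Monic → h.natDegree = n → (g %ₘ R).degree < h.degree := by
    intro g h hh hd
    refine (degree_modByMonic_lt g hR).trans_le ?_
    rw [degree_eq_natDegree hR.ne_zero, degree_eq_natDegree hh.ne_zero, hd]
    exact_mod_cast hn
  have hT2 : ∀ h ∈ monics F n, T h ∈ monics F n := by
    intro h hh
    obtain ⟨h1, h2⟩ := mem_monics.mp hh
    have e : T h = h + ((u * h) %ₘ R - h %ₘ R) := by
      have h1 := modByMonic_add_div h R
      simp only [T]
      linear_combination h1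
    have hdeg : ((u * h) %ₘ R - h %ₘ R).degree < h.degree :=
      (degree_sub_le _ _).trans_lt (max_lt (hlow _ h h1 h2) (hlow _ h h1 h2))
    rw [e]
    refine mem_monics.mpr ⟨h1.add_of_left hdeg, ?_⟩
    rw [natDegree_add_eq_left_of_degree_lt hdeg, h2]
  have hT3 : ∀ a ∈ monics F n, ∀ b ∈ monics F n, T a = T b → a = b := by
    intro a _ b _ hab
    have key : ∀ h, T h /ₘ R = h /ₘ R ∧ T h %ₘ R = (u * h) %ₘ R := by
      intro h
      exact div_modByMonic_unique _ _ hR ⟨by simp only [T]; ring, degree_modByMonic_lt _ hR⟩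
    have h1 : a /ₘ R = b /ₘ R := by rw [← (key a).1, hab, (key b).1]
    have h2 : (u * a) %ₘ R = (u * b) %ₘ R := by rw [← (key a).2, hab, (key b).2]
    have h3 : R ∣ u * (a - b) := by
      have := (modByMonic_eq_zero_iff_dvd hR).mp (show (u * a - u * b) %ₘ R = 0 by
        rw [sub_modByMonic, h2, sub_self])
      rwa [mul_sub]
    have h4 : R ∣ a - b := hu.symm.dvd_of_dvd_mul_left h3
    have h5 := (modByMonic_eq_zero_iff_dvd hR).mpr h4
    rw [sub_modByMonic, sub_eq_zero] at h5
    rw [← modByMonic_add_div a R, ← modByMonic_add_div b R, h1, h5]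
  have hbij : ∑ h ∈ monics F n, G (T h) = ∑ h ∈ monics F n, G h := by
    have hsurj := Finset.surjOn_of_injOn_of_card_le T hT2 hT3 le_rfl
    exact Finset.sum_bij (fun h _ => T h) hT2 (fun a ha b hb h => hT3 a ha b hb h)
      (fun b hb => by obtain ⟨a, ha, hab⟩ := hsurj hb; exact ⟨a, ha, hab⟩) (fun _ _ => rfl)
  rw [Finset.sum_congr rfl fun h _ => hG h (T h) (hT1 h), ← Finset.mul_sum] at hbij
  by_contra hne
  exact hc (mul_right_cancel₀ hne (by rw [hbij, one_mul]))

lemma exists_u {L : ℕ} (p : Fin L → F[X]) (hmon : ∀ i, (p i).Monic)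
    (hirr : ∀ i, Irreducible (p i)) (hdist : Function.Injective p) (v : Fin L → ℕ)
    (χ : MulChar F ℂ) (r : ℕ) (hr : r.Prime) (hχr : χ ^ r = 1) (hχ : χ ≠ 1)
    (i0 : Fin L) (hi0 : ¬ r ∣ v i0) :
    ∃ u : F[X], IsCoprime u (∏ i, p i) ∧ χ (∏ i, resultant (p i) u ^ v i) ≠ 1 := by
  have : Fact r.Prime := ⟨hr⟩
  have hord : orderOf χ = r := orderOf_eq_prime hχr hχ
  have hχv : χ ^ v i0 ≠ 1 := fun h => hi0 (hord ▸ orderOf_dvd_of_pow_eq_one h)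
  obtain ⟨y, hy⟩ := MulChar.ne_one_iff.mp hχv
  obtain ⟨w, hw⟩ := res_surj (p i0) (hmon i0) (hirr i0) y
  have hcop : IsCoprime (p i0) (∏ j ∈ Finset.univ.erase i0, p j) := by
    refine IsCoprime.prod_right fun j hj => ?_
    refine (EuclideanDomain.dvd_or_coprime (p i0) _ (hirr i0)).resolve_left fun hd => ?_
    exact (Finset.ne_of_mem_erase hj) (hdist (eq_of_monic_of_associated (hmon i0) (hmon j)
      ((hirr i0).associated_of_dvd (hirr j) hd))).symm
  obtain ⟨s, t, hst⟩ := hcop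
  set Q := ∏ j ∈ Finset.univ.erase i0, p j with hQ
  let u := s * p i0 + t * Q * w
  have h0 : resultant (p i0) u = y := by
    rw [← hw]
    refine res_congr _ (hmon i0) (hirr i0) ⟨s - s * w, ?_⟩
    simp only [u]
    linear_combination w * hst
  have h1 : ∀ j, j ≠ i0 → resultant (p j) u = 1 := by
    intro j hj
    rw [res_congr (p j) (hmon j) (hirr j) (b := 1)]
    · simp
    · refine (Finset.dvd_prod_of_mem p (Finset.mem_erase.mpr ⟨hj, Finset.mem_univ j⟩)).trans
        ⟨t * w - t, ?_⟩
      simp only [u, hQ] at hst ⊢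
      linear_combination hst
  refine ⟨u, IsCoprime.prod_right fun j _ => res_coprime _ (hmon j) (hirr j) _ ?_, ?_⟩
  · by_cases hj : j = i0
    · rw [hj, h0]; exact y.ne_zero
    · rw [h1 j hj]; exact one_ne_zero
  · rw [Finset.prod_eq_single i0 (fun j _ hj => by rw [h1 j hj, one_pow]) (by simp), h0]
    rwa [map_pow, ← MulChar.pow_apply_coe]

lemma cc_vanish {L : ℕ} (p : Fin L → F[X]) (hmon : ∀ i, (p i).Monic)
    (hirr : ∀ i, Irreducible (p i)) (hdist : Function.Injective p) (v : Fin L → ℕ)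
    (χ : MulChar F ℂ) (r : ℕ) (hr : r.Prime) (hχr : χ ^ r = 1) (hχ : χ ≠ 1)
    (i0 : Fin L) (hi0 : ¬ r ∣ v i0) (n : ℕ) (hn : ∑ i, (p i).natDegree ≤ n) :
    cc (XX χ (∏ i, p i ^ v i)) n = 0 := by
  obtain ⟨u, hu, hu1⟩ := exists_u p hmon hirr hdist v χ r hr hχr hχ i0 hi0
  have hRm : (∏ i, p i).Monic := monic_prod_of_monic _ _ fun i _ => hmon i
  have hRd : (∏ i, p i).natDegree = ∑ i, (p i).natDegree :=
    natDegree_prod_of_monic _ _ fun i _ => hmon i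
  have h := shift_sum (∏ i, p i) u hRm hu n (by rw [hRd]; exact hn)
    (by
      intro h1
      have := Finset.dvd_prod_of_mem p (Finset.mem_univ i0)
      rw [h1] at this
      exact (hirr i0).not_isUnit (isUnit_of_dvd_one this))
    (fun h => χ (∏ i, resultant (p i) h ^ v i)) (χ (∏ i, resultant (p i) u ^ v i))
    (by
      intro h h' hh
      rw [← map_mul, ← Finset.prod_mul_distrib]
      congr 1
      refine Finset.prod_congr rfl fun i _ => ?_
      rw [res_congr (p i) (hmon i) (hirr i)
        ((Finset.dvd_prod_of_mem p (Finset.mem_univ i)).trans hh), res_mul _ (hmon i) (hirr i),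
        mul_pow]) hu1
  rw [cc]
  have e : ∀ h ∈ monics F n, XX χ (∏ i, p i ^ v i) h =
      χ ((-1) ^ (n * (∏ i, p i ^ v i).natDegree)) * χ (∏ i, resultant (p i) h ^ v i) := by
    intro h hh
    rw [XX, res_flip p hmon, map_mul, (mem_monics.mp hh).2]
  rw [Finset.sum_congr rfl e, ← Finset.mul_sum, h, mul_zero]

end VAN


noncomputable def normChar {F K : Type*} [Field F] [Field K] [Algebra F K] [FiniteDimensional F K]
    (χ : MulChar F ℂ) : MulChar K ℂ where
  toFun x := χ (Algebra.norm F x)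
  map_one' := by simp
  map_mul' x y := by simp
  map_nonunit' x hx := by
    have : x = 0 := by simpa using hx
    rw [this, Algebra.norm_zero]
    exact χ.map_nonunit (by simp)

lemma normChar_apply {F K : Type*} [Field F] [Field K] [Algebra F K] [FiniteDimensional F K]
    (χ : MulChar F ℂ) (x : K) : normChar χ x = χ (Algebra.norm F x) := rfl

lemma normChar_pow {F K : Type*} [Field F] [Field K] [Algebra F K] [FiniteDimensional F K]
    (χ : MulChar F ℂ) (r : ℕ) (h : χ ^ r = 1) : (normChar χ : MulChar K ℂ) ^ r = 1 := by
  ext a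
  have hu : IsUnit (Algebra.norm F (a : K)) := a.isUnit.map _
  rw [MulChar.pow_apply_coe, normChar_apply, MulChar.one_apply_coe]
  obtain ⟨b, hb⟩ := hu
  rw [← hb, ← MulChar.pow_apply_coe, h, MulChar.one_apply_coe]

lemma normChar_ne {F K : Type*} [Field F] [Field K] [Finite K] [Algebra F K]
    [FiniteDimensional F K]
    (χ : MulChar F ℂ) (h : χ ≠ 1) : (normChar χ : MulChar K ℂ) ≠ 1 := by
  intro h1
  apply h
  ext a
  obtain ⟨x, hx⟩ := FiniteField.norm_surjective F K a
  have hx0 : x ≠ 0 := by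
    rintro rfl
    rw [Algebra.norm_zero] at hx
    exact a.ne_zero hx.symm
  rw [← hx, ← normChar_apply (K := K), h1, hx, MulChar.one_apply hx0.isUnit, MulChar.one_apply_coe]

lemma factor_at {F K : Type*} [Field F] [Fintype F] [Field K] [Fintype K] [Algebra F K]
    {L : ℕ} (p : Fin L → F[X]) (hmon : ∀ i, (p i).Monic)
    (hirr : ∀ i, Irreducible (p i)) (hdist : Function.Injective p) (v : Fin L → ℕ) (i0 : Fin L)
    (hd : (p i0).natDegree ∣ Module.finrank F K) :
    ∃ (β : K) (u : K[X]), u.eval β ≠ 0 ∧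
      (∏ i, p i ^ v i).map (algebraMap F K) = (X - C β) ^ v i0 * u := by
  have hcard := card_roots_irr (K := K) (p i0) (hirr i0) (hmon i0) hd
  have : Nonempty {x : K // aeval x (p i0) = 0} := by
    by_contra hne
    rw [not_nonempty_iff] at hne
    rw [Nat.card_of_isEmpty] at hcard
    exact (hirr i0).natDegree_pos.ne hcard
  obtain ⟨β, hβ⟩ := this
  have hmin : p i0 = minpoly F β := minpoly.eq_of_irreducible_of_monic (hirr i0) hβ (hmon i0)
  have hroot : ((p i0).map (algebraMap F K)).IsRoot β := by
    rw [IsRoot.def, eval_map_algebraMap, hβ]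
  obtain ⟨w, hw⟩ := dvd_iff_isRoot.mpr hroot
  have hsep : (p i0).Separable := PerfectField.separable_of_irreducible (hirr i0)
  have hwβ : w.eval β ≠ 0 := by
    intro h0
    have h1 : eval β (derivative ((p i0).map (algebraMap F K))) = 0 := by
      rw [hw]; simp [h0]
    have h2 := (hsep.map (f := algebraMap F K)).eval₂_derivative_ne_zero (RingHom.id K) (x := β)
      (by rw [← eval₂_id] at *; simpa [eval₂_id] using hroot)
    exact h2 (by simpa [eval₂_id] using h1)
  refine ⟨β, w ^ v i0 * ∏ j ∈ Finset.univ.erase i0, ((p j).map (algebraMap F K)) ^ v j, ?_, ?_⟩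
  · rw [eval_mul, eval_pow, eval_prod]
    refine mul_ne_zero (pow_ne_zero _ hwβ) (Finset.prod_ne_zero_iff.mpr fun j hj => ?_)
    rw [eval_pow]
    refine pow_ne_zero _ fun h0 => ?_
    rw [eval_map_algebraMap] at h0
    have h1 := minpoly.eq_of_irreducible_of_monic (hirr j) h0 (hmon j)
    exact Finset.ne_of_mem_erase hj (hdist (h1.trans hmin.symm))
  · rw [Polynomial.map_prod, ← Finset.mul_prod_erase _ _ (Finset.mem_univ i0), Polynomial.map_pow,
      hw, mul_pow, mul_assoc]
    congr 2
    refine Finset.prod_congr rfl fun j _ => ?_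
    rw [Polynomial.map_pow]

theorem charsum_weil (F : Type) [Field F] [Fintype F] (r : ℕ) (hr : r.Prime)
    (hrq : r ∣ Fintype.card F - 1)
    {L : ℕ} (p : Fin L → F[X]) (hmon : ∀ i, (p i).Monic)
    (hirr : ∀ i, Irreducible (p i)) (hdist : Function.Injective p) (v : Fin L → ℕ) (i0 : Fin L)
    (hi0 : ¬ r ∣ v i0) (χ : MulChar F ℂ) (hχr : χ ^ r = 1) (hχ : χ ≠ 1) :
    ‖∑ x : F, χ ((∏ i, p i ^ v i).eval x)‖ ≤
      (∑ i, (p i).natDegree : ℕ) * Real.sqrt (Fintype.card F) := by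
  set f := ∏ i, p i ^ v i with hf
  set q := Fintype.card F with hq
  set D := ∑ i, (p i).natDegree with hD
  have hq1 : 1 ≤ q := Fintype.card_pos
  obtain ⟨ω, hω⟩ := newton_roots D (cc (XX χ f)) (SS (XX χ f)) (cc_zero χ f)
    (fun n hn => cc_vanish p hmon hirr hdist v χ r hr hχr hχ i0 hi0 n hn.le)
    (fun n => cc_rec (XX χ f) (fun g h hg hh => XX_mul χ f g h hg hh) (XX_one χ f) n)
  obtain ⟨B, hB⟩ := charsum_bound r f.natDegree hr
  obtain ⟨pc, hpc', a, hpc, hcard⟩ := FiniteField.card' F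
  have : Fact pc.Prime := ⟨hpc⟩
  have hd0 : 1 ≤ (p i0).natDegree := (hirr i0).natDegree_pos
  have hsq : (0:ℝ) < Real.sqrt q := Real.sqrt_pos.mpr (by exact_mod_cast hq1)
  have hω2 : ∀ i, ‖ω i‖ ≤ Real.sqrt q := by
    refine powsum_bound D (2 * (p i0).natDegree) (by omega) ω B (Real.sqrt q) hsq ?_
    intro k hk
    set n := 2 * (p i0).natDegree * k with hn
    have hn1 : 1 ≤ n := Nat.mul_pos (by omega) hk
    have : NeZero n := ⟨by omega⟩
    let K := FiniteField.Extension F pc n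
    have : Fintype K := Fintype.ofFinite K
    have hfr : Module.finrank F K = n := FiniteField.finrank_extension F pc n
    have hcK : Fintype.card K = q ^ n := by
      rw [Fintype.card_eq_nat_card, FiniteField.natCard_extension, Nat.card_eq_fintype_card]
    have : CharP K pc := charP_of_injective_algebraMap (algebraMap F K).injective pc
    have h1 := hω n hn1
    rw [SS_eq (K := K) χ f n hfr] at h1
    obtain ⟨β, u, hu, hfu⟩ := factor_at (K := K) p hmon hirr hdist v i0
      (by rw [hfr, hn]; exact ⟨2 * k, by ring⟩)
    have hM : q ^ ((p i0).natDegree * k) = pc ^ (a * ((p i0).natDegree * k)) := by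
      rw [hq, hcard, ← pow_mul]
    have h2 := hB K pc (a * ((p i0).natDegree * k)) (q ^ ((p i0).natDegree * k)) hM
      (by rw [hcK, ← pow_add, hn]; congr 1; ring)
      (hrq.trans (by simpa using Nat.sub_dvd_pow_sub_pow q 1 ((p i0).natDegree * k)))
      (v i0) (((hr.coprime_iff_not_dvd).mpr hi0).symm) β u hu (f.map (algebraMap F K)) hfu
      (natDegree_map_eq_of_injective (algebraMap F K).injective f)
      (normChar χ) (normChar_pow χ r hχr) (normChar_ne χ hχ)
    have h3 : ∑ x : K, (normChar χ : MulChar K ℂ) ((f.map (algebraMap F K)).eval x) =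
        - ∑ i, ω i ^ n := by
      rw [← h1]
      refine Finset.sum_congr rfl fun x _ => ?_
      rw [normChar_apply, eval_map_algebraMap]
    rw [h3, norm_neg] at h2
    refine h2.trans (le_of_eq ?_)
    congr 1
    rw [hn, mul_assoc, pow_mul (Real.sqrt q) 2, Real.sq_sqrt (by positivity)]
    push_cast
    rfl
  have h1 := hω 1 le_rfl
  rw [SS_eq (K := F) χ f 1 (Module.finrank_self F)] at h1
  have h2 : ∑ x : F, χ (f.eval x) = - ∑ i, ω i ^ 1 := by
    rw [← h1]
    refine Finset.sum_congr rfl fun x _ => ?_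
    rw [Algebra.norm_self, coe_aeval_eq_eval]
    rfl
  rw [h2, norm_neg]
  refine (norm_sum_le _ _).trans ?_
  refine (Finset.sum_le_sum (g := fun _ => Real.sqrt q) fun i _ => by rw [pow_one]; exact hω2 i).trans ?_
  simp


lemma charsum_pointwise {F : Type} [Field F] (χ : MulChar F ℂ) (r : ℕ) (hr : r.Prime)
    (hχ : χ ^ r = 1) (y : F) :
    0 ≤ (∑ j ∈ Finset.range r, (χ ^ j) y).re ∧
    ((∃ b : F, b ≠ 0 ∧ b ^ r = y) → (∑ j ∈ Finset.range r, (χ ^ j) y).re = r) := by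
  by_cases hy : y = 0
  · subst hy
    constructor
    · rw [Finset.sum_eq_zero fun j _ => (χ ^ j).map_nonunit (by simp)]
      simp
    · rintro ⟨b, hb, hb'⟩
      exact absurd hb' (pow_ne_zero _ hb)
  · have hroot : ∀ z : F, z ≠ 0 → χ z ^ r = 1 := by
      intro z hz
      have := congrArg (fun ψ : MulChar F ℂ => ψ (Units.mk0 z hz)) hχ
      simp only [MulChar.pow_apply_coe, MulChar.one_apply_coe] at this
      exact this
    have hs : ∑ j ∈ Finset.range r, (χ ^ j) y = ∑ j ∈ Finset.range r, χ y ^ j := by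
      refine Finset.sum_congr rfl fun j _ => ?_
      have := MulChar.pow_apply_coe χ j (Units.mk0 y hy)
      simpa using this
    rw [hs]
    constructor
    · by_cases h1 : χ y = 1
      · simp [h1]
      · rw [geom_sum_eq h1, hroot y hy]; simp
    · rintro ⟨b, hb, rfl⟩
      rw [map_pow, hroot b hb]; simp

theorem count_rth_power_values_le
    (q r L : ℕ) (F : Type) [Field F] [Fintype F]
    (hq : Fintype.card F = q) (hpp : ∃ p k : ℕ, p.Prime ∧ 0 < k ∧ q = p ^ k)
    (hr : r.Prime) (hdvd : r ∣ q - 1)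
    (p : Fin L → Polynomial F) (hmon : ∀ i, (p i).Monic)
    (hirr : ∀ i, Irreducible (p i)) (hdist : Function.Injective p)
    (v : Fin L → ℕ) (hv : ¬ ∀ i, (v i : ZMod r) = 0)
    (f : Polynomial F) (hf : f = ∏ i, (p i) ^ (v i)) :
    ({x : F | f.eval x ≠ 0 ∧ ∃ b : F, b ≠ 0 ∧ b ^ r = f.eval x}.ncard : ℝ)
      ≤ (q : ℝ) / r
        + (L : ℝ) * (Finset.univ.sup fun i => (p i).natDegree : ℕ) * Real.sqrt q := by
  classical
  push Not at hv
  obtain ⟨i0, hi0⟩ := hv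
  rw [Ne, ZMod.natCast_eq_zero_iff] at hi0
  obtain ⟨χ, hχord⟩ := MulChar.exists_mulChar_orderOf F (n := r) (by rw [hq]; exact hdvd)
    (Complex.isPrimitiveRoot_exp r hr.ne_zero)
  have hχr : χ ^ r = 1 := by rw [← hχord]; exact pow_orderOf_eq_one χ
  set D := ∑ i, (p i).natDegree with hD
  have hDle : D ≤ L * Finset.univ.sup fun i => (p i).natDegree := by
    have := Finset.sum_le_card_nsmul Finset.univ (fun i => (p i).natDegree) _
      (fun i hi => Finset.le_sup (f := fun i => (p i).natDegree) hi)
    simpa using this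
  set S := {x : F | f.eval x ≠ 0 ∧ ∃ b : F, b ≠ 0 ∧ b ^ r = f.eval x} with hS
  have hrpos : (0:ℝ) < r := by exact_mod_cast hr.pos
  have hpos : 0 ≤ (D : ℝ) * Real.sqrt q := by positivity
  have hlow : (r : ℝ) * S.ncard ≤ (∑ x : F, ∑ j ∈ Finset.range r, (χ ^ j) (f.eval x)).re := by
    rw [Complex.re_sum]
    have h1 : (r : ℝ) * S.ncard = ∑ x : F, if x ∈ S then (r : ℝ) else 0 := by
      rw [← Finset.sum_filter, Finset.sum_const, nsmul_eq_mul, Set.ncard_eq_toFinset_card', mul_comm]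
      congr 3
      ext x; simp
    rw [h1]
    refine Finset.sum_le_sum fun x _ => ?_
    obtain ⟨ha, hb⟩ := charsum_pointwise χ r hr hχr (f.eval x)
    split_ifs with hx
    · exact (hb hx.2).ge
    · exact ha
  have hup : (∑ x : F, ∑ j ∈ Finset.range r, (χ ^ j) (f.eval x)).re ≤
      q + r * (D * Real.sqrt q) := by
    rw [Finset.sum_comm]
    refine (Complex.re_le_norm _).trans ((norm_sum_le _ _).trans ?_)
    have hb : ∀ j ∈ Finset.range r, ‖∑ x : F, (χ ^ j) (f.eval x)‖ ≤
        (if j = 0 then (q : ℝ) else 0) + D * Real.sqrt q := by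
      intro j hj
      rw [Finset.mem_range] at hj
      split_ifs with h0
      · subst h0
        refine (norm_sum_le _ _).trans ?_
        have : ∑ x : F, ‖(χ ^ 0) (f.eval x)‖ ≤ ∑ x : F, (1 : ℝ) := by
          refine Finset.sum_le_sum fun x _ => ?_
          rw [pow_zero]
          by_cases hx : IsUnit (f.eval x)
          · rw [MulChar.one_apply hx]; simp
          · rw [MulChar.map_nonunit _ hx]; simp
        refine this.trans ?_
        simpa [hq] using hpos
      · rw [zero_add, hf, ← hq]
        refine charsum_weil F r hr (by rw [hq]; exact hdvd) p hmon hirr hdist v i0 hi0 (χ ^ j) ?_ ?_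
        · rw [← pow_mul, mul_comm, pow_mul, hχr, one_pow]
        · intro h1
          have := orderOf_dvd_of_pow_eq_one h1
          rw [hχord] at this
          exact absurd (Nat.le_of_dvd (Nat.pos_of_ne_zero h0) this) (by omega)
    refine (Finset.sum_le_sum hb).trans ?_
    rw [Finset.sum_add_distrib, Finset.sum_ite_eq' (Finset.range r) 0,
      if_pos (Finset.mem_range.mpr hr.pos)]
    simp
  have hfin : (S.ncard : ℝ) ≤ q / r + D * Real.sqrt q := by
    have := hlow.trans hup
    rw [div_add' _ _ _ hrpos.ne', le_div_iff₀ hrpos]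
    linarith
  refine hfin.trans ?_
  have : (D : ℝ) ≤ (L : ℝ) * (Finset.univ.sup fun i => (p i).natDegree : ℕ) := by
    exact_mod_cast hDle
  gcongr
end

section
/- Let C = C(χ_r, P) be an (r,P)-shadow code of length n = q with P = {p_1,...,p_L} monic irreducible polynomials of degree at least 2 in F_q[x]. Then the minimum distance of C is at least (r-1)q/r − L·max{deg p_i : 1 ≤ i ≤ L}·√q. -/
/-- The shadow-code evaluation map. -/
noncomputable def shadowEv {F : Type} [Field F] [Fintype F] {r L : ℕ}
    (χ : Fˣ →* (rootsOfUnity r ℂ)) (φ : (rootsOfUnity r ℂ) → ZMod r)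
    (p : Fin L → Polynomial F) (hnz : ∀ i (x : F), (p i).eval x ≠ 0) :
    (Fin L → ZMod r) → (F → ZMod r) :=
  fun v x => φ (χ (∏ i, (Units.mk0 ((p i).eval x) (hnz i x)) ^ (v i).val))


lemma shadow_arith0 (q M Q t : ℝ) (hQQ : Q * Q = q) (ht0 : 0 ≤ t) (ht1 : t < 1) (hQt : Q = M + t)
    (h3R : 3 ≤ M) (hM2R : q + 1 ≤ (M + 1) * (M + 1)) : 0 ≤ q / 2 * (1 - t * t) - 1 := by
  have hq : q = M * M + 2 * M * t + t * t := by rw [← hQQ, hQt]; ring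
  have hMt : 0 ≤ M * t := by positivity
  have hM9 : 9 ≤ M * M := by nlinarith only [h3R]
  by_cases htt : t ≤ 1 / 2
  · have h1 : t * t ≤ 1 / 4 := by nlinarith only [ht0, htt]
    have h2 : 9 ≤ q := by nlinarith only [hq, hMt, hM9, mul_self_nonneg t]
    nlinarith only [h1, h2]
  · push Not at htt
    have h7 : 1 ≤ (1 - t) * (2 * M + 2) := by nlinarith only [hM2R, hq, ht1]
    have h8 : M * M + M + 1 / 4 ≤ q := by nlinarith only [hq, htt, h3R]
    have h11 : 4 * (M + 1) ≤ 3 / 2 * q := by nlinarith only [h8, h3R]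
    have h10 : 3 / 2 * (1 - t) ≤ 1 - t * t := by nlinarith only [ht1, htt]
    have h12 : 2 ≤ 3 / 2 * q * (1 - t) := by
      have := mul_le_mul_of_nonneg_right h11 (by linarith : 0 ≤ 1 - t)
      linarith
    have h13 := mul_le_mul_of_nonneg_left h10 (by linarith : 0 ≤ q)
    linarith

lemma shadow_arith1 (q s m N M K Q ρ t : ℝ) (hQ0 : 0 ≤ Q) (hQQ : Q * Q = q)
    (hqR : 0 < q) (hsR : 1 ≤ s) (hmR : 2 ≤ m) (hMR0 : 0 ≤ M) (hM1R : M * M ≤ q)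
    (hρ0 : 0 < ρ) (hρs : ρ * (q - 1) = s) (hρ2 : ρ ≤ 1 / 2)
    (hN : s + ρ + m * Q < N) (ht0 : 0 ≤ t) (ht1 : t < 1) (hQt : Q = M + t) (hq1 : 0 ≤ q - 1)
    (hM2' : 2 ≤ M) (hcR : m + 2 ≤ M) (hKNR : q * K ≤ M * N - 1 + q) :
    (q * (M * (s + K - 1) + (m - 1) * M * (M - 1) / 2)
      < (q - 1) * (M * N) - m * (q - 1) * (q - 1 - s) / 2) := by
  have hM4 : (4 : ℝ) ≤ M := by linarith
  have h1 : (q - 1 - M) * M * (s + ρ + m * Q) ≤ (q - 1 - M) * M * N := by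
    apply mul_le_mul_of_nonneg_left hN.le
    apply mul_nonneg _ hMR0
    nlinarith
  have h2 : M * (q * K) ≤ M * (M * N - 1 + q) := mul_le_mul_of_nonneg_left hKNR hMR0
  have hb : -(q * M) / 2 - 1 / 2 ≤ (q - 1 - M) * M * Q - (q - 1) * (q - 1) / 2 - q * M * (M - 1) / 2 := by
    have e : (q - 1 - M) * M * Q - (q - 1) * (q - 1) / 2 - q * M * (M - 1) / 2
       - (-(q * M) / 2 - 1 / 2) = Q * t * (M - Q * t / 2) + Q * t := by
      rw [← hQQ, hQt]; ring
    have : Q * t ≤ 2 * M := by nlinarith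
    have h3 : 0 ≤ Q * t := mul_nonneg hQ0 ht0
    have h4 : 0 ≤ Q * t * (M - Q * t / 2) := mul_nonneg h3 (by linarith)
    linarith
  have h5 := mul_le_mul_of_nonneg_left hb (by linarith : (0 : ℝ) ≤ m)
  have h6 : (q - 1) * s ≤ m * ((q - 1) * s / 2) := by
    have : 0 ≤ (q - 1) * s := mul_nonneg hq1 (by linarith)
    nlinarith
  have h7 : s ≤ (q - 1) / 2 := by rw [← hρs]; nlinarith
  have h8 : M * M * s ≤ q * s := mul_le_mul_of_nonneg_right hM1R (by linarith)
  have h9 : ρ * (M * M) ≤ q / 2 := by nlinarith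
  have h10 : m * (q * M + 1) ≤ (M - 2) * (q * M + 1) :=
    mul_le_mul_of_nonneg_right (by linarith) (by positivity)
  have h11 : 4 * q ≤ M * q := by nlinarith
  have h12 : (q - 1 - M) * M * (s + ρ + m * Q) = (q - 1 - M) * M * s + s * M - ρ * (M * M) + m * ((q - 1 - M) * M * Q) := by
    rw [← hρs]; ring
  linarith

lemma shadow_arith2 (q s m N M K Q ρ t : ℝ) (hQ0 : 0 ≤ Q) (hQQ : Q * Q = q)
    (hqR : 0 < q) (hsR : 1 ≤ s) (hmR : 2 ≤ m) (hMR0 : 0 ≤ M) (hM1R : M * M ≤ q)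
    (hρ0 : 0 < ρ) (hρs : ρ * (q - 1) = s) (hρ2 : ρ ≤ 1 / 2)
    (hN : s + ρ + m * Q < N) (ht0 : 0 ≤ t) (ht1 : t < 1) (hQt : Q = M + t) (hq1 : 0 ≤ q - 1)
    (hM2' : 2 ≤ M) (hcR : M ≤ m + 1) (hM2R : q + 1 ≤ (M + 1) * (M + 1))
    (hcase : 3 ≤ M ∨ (M = 2 ∧ m = 2)) (hKMR : K ≤ M) :
    (q * (M * (s + K - 1) + (m - 1) * M * (M - 1) / 2)
      < (q - 1) * (M * N) - m * (q - 1) * (q - 1 - s) / 2) := by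
  have h1 : (q - 1) * M * (s + ρ + m * Q) < (q - 1) * M * N := by
    apply mul_lt_mul_of_pos_left hN
    apply mul_pos _ (by linarith)
    nlinarith
  have h2 : q * M * K ≤ q * M * M := mul_le_mul_of_nonneg_left hKMR (by positivity)
  have h12 : (q - 1) * M * (s + ρ + m * Q) = (q - 1) * M * s + s * M + m * ((q - 1) * M * Q) := by
    rw [← hρs]; ring
  have hb : q / 2 * (1 - t * t) - 1 + q * M / 2 ≤ (q - 1) * M * Q - (q - 1) * (q - 1) / 2 + (q - 1) * s / 2 - q * M * (M - 1) / 2 := by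
    have h3 : (q - 1) * 1 ≤ (q - 1) * s := mul_le_mul_of_nonneg_left hsR hq1
    have e : (q - 1) * M * Q - (q - 1) * (q - 1) / 2 + (q - 1) * 1 / 2 - q * M * (M - 1) / 2 - (q / 2 * (1 - t * t) - 1 + q * M / 2) = Q * t := by
      rw [← hQQ, hQt]; ring
    have h3' : 0 ≤ Q * t := mul_nonneg hQ0 ht0
    linarith
  have h5 := mul_le_mul_of_nonneg_left hb (by linarith : (0 : ℝ) ≤ m)
  have key : 0 ≤ m * (q / 2 * (1 - t * t) - 1) + q * M * (m + 1 - M) / 2 := by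
    rcases hcase with h3R | ⟨hMr, hmr⟩
    · have : 0 ≤ q / 2 * (1 - t * t) - 1 := by
        exact shadow_arith0 q M Q t hQQ ht0 ht1 hQt h3R hM2R
      have h6 : 0 ≤ q * M * (m + 1 - M : ℝ) := mul_nonneg (by positivity) (by linarith)
      have h7 : 0 ≤ m * (q / 2 * (1 - t * t) - 1) := mul_nonneg (by linarith) this
      linarith
    · rw [hMr, hmr]
      rw [hMr] at hM1R
      have : 0 ≤ q * (1 - t * t) := mul_nonneg hqR.le (by nlinarith)
      linarith
  linarith


lemma shadow_arith (q r s m N M K : ℕ) (hqs : q = r * s + 1) (hr : 2 ≤ r) (hs : 1 ≤ s) (hm : 2 ≤ m)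
    (hM : M = Nat.sqrt q) (hNq : N ≤ q) (hN : (q : ℝ) / r + m * Real.sqrt q < N)
    (hK : K = (M * N - 1) / q + 1) :
    (q : ℝ) * (M * ((s : ℝ) + K - 1) + ((m : ℝ) - 1) * M * (M - 1) / 2)
      < s * (r * (M * N) - s * m * r * (r - 1) / 2) := by
  have hq0 : 0 < q := by omega
  have hqs' : (r : ℝ) * s = q - 1 := by rw [hqs]; push_cast; ring
  have hM1 : M * M ≤ q := hM ▸ Nat.sqrt_le q
  have hM2 : q < (M + 1) * (M + 1) := hM ▸ Nat.lt_succ_sqrt q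
  set Q := Real.sqrt q with hQ
  have hQ0 : 0 ≤ Q := Real.sqrt_nonneg _
  have hQQ : Q * Q = q := Real.mul_self_sqrt (Nat.cast_nonneg _)
  have hqR : (0 : ℝ) < q := by exact_mod_cast hq0
  have hrR : (2 : ℝ) ≤ r := by exact_mod_cast hr
  have hsR : (1 : ℝ) ≤ s := by exact_mod_cast hs
  have hmR : (2 : ℝ) ≤ m := by exact_mod_cast hm
  have hNqR : (N : ℝ) ≤ q := by exact_mod_cast hNq
  have hMR0 : (0 : ℝ) ≤ M := Nat.cast_nonneg _
  have hM1R : (M : ℝ) * M ≤ q := by exact_mod_cast hM1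
  have hM2R : (q : ℝ) + 1 ≤ (M + 1) * (M + 1) := by exact_mod_cast hM2
  have hMQ : (M : ℝ) ≤ Q := by
    by_contra h; push Not at h
    nlinarith
  have hQM : Q < M + 1 := by
    by_contra h; push Not at h
    nlinarith
  obtain ⟨ρ, hρ⟩ : ∃ ρ : ℝ, ρ = 1 / r := ⟨_, rfl⟩
  have hρr : ρ * r = 1 := by rw [hρ]; field_simp
  have hρ0 : 0 < ρ := by rw [hρ]; positivity
  have hρs : ρ * (q - 1) = s := by rw [← hqs', ← mul_assoc, hρr, one_mul]
  have hρ2 : ρ ≤ 1 / 2 := by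
    rw [hρ]; exact one_div_le_one_div_of_le (by norm_num) hrR
  have hqr : (q : ℝ) / r = s + ρ := by
    have : (q : ℝ) / r = q * ρ := by rw [hρ]; ring
    rw [this]; linarith
  rw [hqr] at hN
  have hQpos : 0 < Q := Real.sqrt_pos.2 hqR
  have hmQ : (m : ℝ) < Q := by
    by_contra h; push Not at h
    nlinarith
  have hmM : m ≤ M := by
    have : (m : ℝ) < M + 1 := by linarith
    have : m < M + 1 := by exact_mod_cast this
    omega
  have hmMR : (m : ℝ) ≤ M := by exact_mod_cast hmM
  have hNpos : 0 < N := by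
    have : (0 : ℝ) < N := by
      have : 0 ≤ (m : ℝ) * Q := by positivity
      linarith
    exact_mod_cast this
  have hMN : 0 < M * N := Nat.mul_pos (by omega) hNpos
  have hKM : K ≤ M := by
    rw [hK]
    have : (M * N - 1) / q < M := by
      rw [Nat.div_lt_iff_lt_mul hq0]
      have : M * N ≤ M * q := Nat.mul_le_mul_left _ hNq
      omega
    omega
  have hKN : q * K ≤ M * N - 1 + q := by
    rw [hK, mul_add, mul_one]
    have := Nat.mul_div_le (M * N - 1) q
    omega
  have hKNR : (q : ℝ) * K ≤ M * N - 1 + q := by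
    have : q * K + 1 ≤ M * N + q := by omega
    have : (q : ℝ) * K + 1 ≤ M * N + q := by exact_mod_cast this
    linarith
  have hKMR : (K : ℝ) ≤ M := by exact_mod_cast hKM
  have hRHS : (s : ℝ) * (r * (M * N) - s * m * r * (r - 1) / 2)
      = (q - 1) * (M * N) - m * (q - 1) * (q - 1 - s) / 2 := by
    have : (s : ℝ) * (r * (M * N) - s * m * r * (r - 1) / 2)
      = (r * s) * (M * N) - m * (r * s) * (r * s - s) / 2 := by ring
    rw [this, hqs']
  rw [hRHS]
  obtain ⟨t, ht⟩ : ∃ t : ℝ, t = Q - M := ⟨_, rfl⟩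
  have ht0 : 0 ≤ t := by linarith
  have ht1 : t < 1 := by linarith
  have hQt : Q = M + t := by linarith
  have hq1 : (0 : ℝ) ≤ q - 1 := by
    have : (1 : ℝ) ≤ q := by exact_mod_cast hq0
    linarith
  have hM2' : (2 : ℝ) ≤ M := by linarith
  by_cases hc : m + 2 ≤ M
  · have hcR : (m : ℝ) + 2 ≤ M := by exact_mod_cast hc
    exact shadow_arith1 _ _ _ _ _ _ Q ρ t hQ0 hQQ hqR hsR hmR hMR0 hM1R hρ0 hρs hρ2 hN ht0 ht1 hQt hq1 hM2' hcR hKNR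
  · have hcR : (M : ℝ) ≤ m + 1 := by
      have : M ≤ m + 1 := by omega
      exact_mod_cast this
    refine shadow_arith2 _ _ _ _ _ _ Q ρ t hQ0 hQQ hqR hsR hmR hMR0 hM1R hρ0 hρs hρ2 hN ht0 ht1 hQt hq1 hM2' hcR hM2R ?_ hKMR
    rcases (show 3 ≤ M ∨ (M = 2 ∧ m = 2) by omega) with h | ⟨h, h'⟩
    · left; exact_mod_cast h
    · right; rw [h, h']; norm_num

section
open Polynomial

lemma shadow_count (q s Y : ℕ) (hs : s ≤ q) (hq : 0 < q) :
    s * Y ≤ q * ((Finset.range Y).filter (fun n => n % q < s)).card := by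
  have key : ∀ Y, ((Finset.range Y).filter (fun n => n % q < s)).card = (Y / q) * s + min (Y % q) s := by
    intro Y
    induction Y with
    | zero => simp
    | succ Y ih =>
      rw [Finset.range_add_one, Finset.filter_insert]
      have hlt := Nat.mod_lt Y hq
      have hdm := Nat.div_add_mod Y q
      by_cases h1 : Y % q + 1 = q
      · have e1 : (Y + 1) / q = Y / q + 1 := by
          rw [show Y + 1 = q * (Y / q + 1) by rw [mul_add, mul_one]; omega]
          rw [Nat.mul_div_cancel_left _ hq]
        have e2 : (Y + 1) % q = 0 := by
          rw [show Y + 1 = q * (Y / q + 1) by rw [mul_add, mul_one]; omega]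
          exact Nat.mul_mod_right _ _
        rw [e1, e2, add_mul]
        split_ifs with h
        · rw [Finset.card_insert_of_notMem (by simp), ih]; omega
        · rw [ih]; omega
      · have h2 : Y % q + 1 < q := by omega
        have e0 : Y + 1 = Y % q + 1 + q * (Y / q) := by omega
        have e1 : (Y + 1) / q = Y / q := by
          conv_lhs => rw [e0]
          rw [Nat.add_mul_div_left _ _ hq, Nat.div_eq_of_lt h2, zero_add]
        have e2 : (Y + 1) % q = Y % q + 1 := by
          conv_lhs => rw [e0]
          rw [Nat.add_mul_mod_self_left, Nat.mod_eq_of_lt h2]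
        rw [e1, e2]
        split_ifs with h
        · rw [Finset.card_insert_of_notMem (by simp), ih]; omega
        · rw [ih]; omega
  rw [key]
  have hdm := Nat.div_add_mod Y q
  have hlt := Nat.mod_lt Y hq
  have : s * (Y % q) ≤ q * min (Y % q) s := by
    rcases le_total (Y % q) s with h | h
    · rw [min_eq_left h]; exact Nat.mul_le_mul_right _ hs
    · rw [min_eq_right h, mul_comm]; exact Nat.mul_le_mul_right _ hlt.le
  calc s * Y = s * (q * (Y / q) + Y % q) := by rw [hdm]
    _ = q * (Y / q * s) + s * (Y % q) := by ring
    _ ≤ _ := by rw [mul_add]; omega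

/-- Sum over residues. -/
lemma shadow_sum_mod (r ε : ℕ) (hr : r.Prime) (h0 : 0 < ε) (h1 : ε < r) :
    ∑ j ∈ Finset.range r, (j * ε) % r = ∑ j ∈ Finset.range r, j := by
  have hinj : Set.InjOn (fun j => (j * ε) % r) (Finset.range r : Set ℕ) := by
    intro a ha b hb hab
    simp only [Finset.coe_range, Set.mem_Iio] at ha hb
    have hc : Nat.Coprime r ε := (Nat.coprime_of_lt_prime h0.ne' h1 hr)
    have := Nat.ModEq.cancel_right_of_coprime hc (show a * ε ≡ b * ε [MOD r] from hab)
    exact Nat.ModEq.eq_of_lt_of_lt this ha hb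
  have him : (Finset.range r).image (fun j => (j * ε) % r) = Finset.range r := by
    apply Finset.eq_of_subset_of_card_le
    · intro x hx
      simp only [Finset.mem_image, Finset.mem_range] at hx ⊢
      obtain ⟨a, _, rfl⟩ := hx
      exact Nat.mod_lt _ hr.pos
    · rw [Finset.card_image_of_injOn hinj]
  conv_rhs => rw [← him]
  rw [Finset.sum_image hinj]

/-- Weighted degree bound. -/
def ShW {K : Type*} [Field K] (e d : ℕ) (P : K[X][X]) : Prop :=
  ∀ l, (P.coeff l).natDegree ≤ d + l * e

lemma ShW.mul {K : Type*} [Field K] {e d d' : ℕ} {P P' : K[X][X]} (h : ShW e d P) (h' : ShW e d' P') :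
    ShW e (d + d') (P * P') := by
  intro l
  rw [coeff_mul]
  apply natDegree_sum_le_of_forall_le
  rintro ⟨a, b⟩ hab
  rw [Finset.HasAntidiagonal.mem_antidiagonal] at hab
  simp only at hab ⊢
  refine natDegree_mul_le.trans ?_
  have := h a
  have := h' b
  subst hab
  rw [add_mul]
  omega

lemma ShW.one {K : Type*} [Field K] {e : ℕ} : ShW e 0 (1 : K[X][X]) := by
  intro l
  rw [coeff_one]
  split_ifs <;> simp

lemma ShW.pow {K : Type*} [Field K] {e d : ℕ} {P : K[X][X]} (h : ShW e d P) (n : ℕ) :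
    ShW e (n * d) (P ^ n) := by
  induction n with
  | zero => simpa using ShW.one
  | succ n ih => rw [pow_succ, add_mul, one_mul]; exact ih.mul h

lemma ShW.prod {K : Type*} [Field K] {ι : Type*} {e : ℕ} (T : Finset ι) (f : ι → K[X][X])
    (h : ∀ i ∈ T, ShW e 0 (f i)) : ShW e 0 (∏ i ∈ T, f i) := by
  classical
  induction T using Finset.induction_on with
  | empty => simpa using ShW.one
  | insert a T ha ih =>
    rw [Finset.prod_insert ha]
    exact (h a (by simp)).mul (ih fun i hi => h i (by simp [hi]))

lemma ShW.lin {K : Type*} [Field K] {e d : ℕ} {a b : K[X]} (ha : a.natDegree ≤ d)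
    (hb : b.natDegree ≤ d + e) : ShW e d (C a + X * C b) := by
  intro l
  rw [coeff_add, coeff_C]
  rcases l with _ | _ | l
  · simpa using ha
  · simpa [coeff_X_mul] using hb
  · simp [coeff_X_mul]

lemma ShW.mono {K : Type*} [Field K] {e d d' : ℕ} {P : K[X][X]} (h : ShW e d P) (hd : d ≤ d') :
    ShW e d' P := fun l => (h l).trans (by omega)

/-- Linear algebra. -/
lemma shadow_linalg {K : Type*} [Field K] {ι : Type*} (I : Finset ι) (P : ι → K[X][X]) (e d M : ℕ)
    (hW : ∀ i ∈ I, ShW e d (P i)) (hcard : ∑ l ∈ Finset.range M, (d + l * e + 1) < I.card) :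
    ∃ c : ι → K, (∃ i ∈ I, c i ≠ 0) ∧ ∀ l < M, (∑ i ∈ I, C (C (c i)) * P i).coeff l = 0 := by
  classical
  let Φ : (I → K) →ₗ[K] ((Σ l : Fin M, Fin (d + l * e + 1)) → K) :=
    { toFun := fun c x => ∑ i : I, c i * ((P i).coeff x.1).coeff x.2
      map_add' := by
        intro a b; ext x; simp [add_mul, Finset.sum_add_distrib]
      map_smul' := by
        intro a b; ext x; simp [Finset.mul_sum, mul_assoc] }
  have hlt : Module.finrank K ((Σ l : Fin M, Fin (d + l * e + 1)) → K) < Module.finrank K (I → K) := by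
    rw [Module.finrank_fintype_fun_eq_card, Module.finrank_fintype_fun_eq_card, Fintype.card_sigma]
    simpa [Finset.sum_range] using hcard
  have hker := LinearMap.ker_ne_bot_of_finrank_lt (f := Φ) hlt
  obtain ⟨c, hc, hc0⟩ := (Submodule.ne_bot_iff _).1 hker
  refine ⟨fun i => if h : i ∈ I then c ⟨i, h⟩ else 0, ?_, ?_⟩
  · obtain ⟨i, hi⟩ := Function.ne_iff.1 hc0
    exact ⟨i, i.2, by simpa using hi⟩
  · intro l hl
    ext n
    rw [finsetSum_coeff, finsetSum_coeff]
    simp only [coeff_C_mul, coeff_zero]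
    by_cases hn : n < d + l * e + 1
    · have := congrFun (LinearMap.mem_ker.1 hc) ⟨⟨l, hl⟩, ⟨n, hn⟩⟩
      simp only [Φ, LinearMap.coe_mk, AddHom.coe_mk, Pi.zero_apply] at this
      rw [← this, ← Finset.sum_coe_sort I]
      apply Finset.sum_congr rfl
      rintro ⟨i, hi⟩ _
      simp [hi]
    · apply Finset.sum_eq_zero
      intro i hi
      rw [coeff_eq_zero_of_natDegree_lt (lt_of_le_of_lt (hW i hi l) (by omega)), mul_zero]

/-- Nonvanishing by distinct orders. -/
lemma shadow_nonvanish {K : Type*} [Field K] {ι : Type*} (I : Finset ι) (o : ι → ℕ) (h : ι → K[X])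
    (ho : Set.InjOn o (I : Set ι)) (hh : ∀ i ∈ I, (h i).coeff 0 ≠ 0) (c : ι → K)
    (hc : ∃ i ∈ I, c i ≠ 0) : ∑ i ∈ I, C (c i) * (X ^ o i * h i) ≠ 0 := by
  classical
  obtain ⟨i, hi, hmin⟩ := Finset.exists_min_image (I.filter (fun i => c i ≠ 0)) o
    (by obtain ⟨i, hi, h⟩ := hc; exact ⟨i, by simp [hi, h]⟩)
  rw [Finset.mem_filter] at hi
  intro h0
  have := congrArg (fun p => p.coeff (o i)) h0
  simp only [finsetSum_coeff, coeff_C_mul, coeff_zero] at this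
  rw [Finset.sum_eq_single i] at this
  · have h2 : (X ^ o i * h i).coeff (o i) = (h i).coeff 0 := by
      simpa using coeff_X_pow_mul (h i) (o i) 0
    rw [h2] at this
    exact (mul_ne_zero hi.2 (hh i hi.1)) this
  · intro j hj hji
    by_cases hcj : c j = 0
    · simp [hcj]
    · have hle := hmin j (by simp [hj, hcj])
      have hne : o i ≠ o j := fun he => hji (ho hj hi.1 he.symm)
      rw [coeff_X_pow_mul', if_neg (by omega), mul_zero]
  · intro h; exact absurd hi.1 h

/-- The local expansion at a point. -/
lemma shadow_local {K : Type*} [Field K] {ι : Type*} [DecidableEq ι] (q M n : ℕ) (hMq : M ≤ q)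
    (hfrob : ∀ A B : K[X], (A + B) ^ q = A ^ q + B ^ q)
    (T : Finset ι) (α : ι → K) (e : ι → ℕ) (b x : K) (hx : x ^ q = x + b)
    (hx3 : ∏ i ∈ T, (x - α i) ^ e i = 1) :
    X ^ M ∣ (X ^ n * ∏ i ∈ T, (X - C (α i)) ^ e i).comp
        (C x + X * C (∏ i ∈ T, (x - α i)))
      - ((C X + X * C (∏ i ∈ T, (X - C (α i)))) ^ (n % q)
          * (∏ i ∈ T, (C 1 + X * C (∏ i' ∈ T.erase i, (X - C (α i')))) ^ e i)
          * (C (X + C b) + X * C 0) ^ (n / q) : K[X][X]).map (evalRingHom x) := by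
  set c := ∏ i ∈ T, (x - α i) with hc
  set Y : K[X] := C x + X * C c with hY
  have e1 : (X ^ n * ∏ i ∈ T, (X - C (α i)) ^ e i).comp Y
      = Y ^ (n % q) * (∏ i ∈ T, (1 + X * C (∏ i' ∈ T.erase i, (x - α i'))) ^ e i) * (Y ^ q) ^ (n / q) := by
    rw [mul_comp, X_pow_comp, prod_comp]
    have h1 : Y ^ n = Y ^ (n % q) * (Y ^ q) ^ (n / q) := by
      rw [← pow_mul, ← pow_add, Nat.mod_add_div]
    have h2 : ∏ i ∈ T, ((X - C (α i)) ^ e i).comp Y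
        = ∏ i ∈ T, (C ((x - α i) ^ e i) * (1 + X * C (∏ i' ∈ T.erase i, (x - α i'))) ^ e i) := by
      apply Finset.prod_congr rfl
      intro i hi
      rw [pow_comp, sub_comp, X_comp, C_comp, C_pow, ← mul_pow]
      congr 1
      rw [hY, hc, ← Finset.mul_prod_erase T _ hi]
      simp only [C_mul, C_sub]
      ring
    rw [h1, h2, Finset.prod_mul_distrib, ← map_prod, hx3, C_1]
    ring
  have e2 : ((C X + X * C (∏ i ∈ T, (X - C (α i)))) ^ (n % q)
          * (∏ i ∈ T, (C 1 + X * C (∏ i' ∈ T.erase i, (X - C (α i')))) ^ e i)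
          * (C (X + C b) + X * C 0) ^ (n / q) : K[X][X]).map (evalRingHom x)
      = Y ^ (n % q) * (∏ i ∈ T, (1 + X * C (∏ i' ∈ T.erase i, (x - α i'))) ^ e i) * (C (x + b)) ^ (n / q) := by
    simp [Polynomial.map_mul, Polynomial.map_pow, Polynomial.map_prod, Polynomial.map_add, hY, hc]
  rw [e1, e2, ← mul_sub]
  apply Dvd.dvd.mul_left
  have e3 : Y ^ q - C (x + b) = X ^ q * C c ^ q := by
    rw [hY, hfrob, ← C_pow, hx, mul_pow]; ring
  exact ((pow_dvd_pow X hMq).trans (Dvd.intro _ e3.symm)).trans (sub_dvd_pow_sub_pow _ _ _)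

lemma shadow_untranslate {K : Type*} [Field K] (R : K[X]) (x c : K) (hc : c ≠ 0) (M : ℕ)
    (h : X ^ M ∣ R.comp (C x + X * C c)) : (X - C x) ^ M ∣ R := by
  obtain ⟨S, hS⟩ := h
  have h1 := congrArg (fun p => p.comp ((X - C x) * C c⁻¹)) hS
  simp only [comp_assoc, mul_comp, X_pow_comp] at h1
  have h2 : (C x + X * C c).comp ((X - C x) * C c⁻¹) = X := by
    simp only [add_comp, C_comp, mul_comp, X_comp]
    rw [mul_assoc, ← C_mul, inv_mul_cancel₀ hc]; simp
  rw [h2, comp_X, mul_pow, mul_assoc] at h1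
  exact Dvd.intro _ h1.symm

lemma shadow_stepanov0 {K : Type*} [Field K] {ι : Type*} [DecidableEq ι] (q r s : ℕ) (hr : r.Prime)
    (hqs : q = r * s + 1) (hs : 1 ≤ s)
    (hfrob : ∀ A B : K[X], (A + B) ^ q = A ^ q + B ^ q)
    (T : Finset ι) (α : ι → K) (ε : ι → ℕ) (hε : ∀ i ∈ T, 0 < ε i ∧ ε i < r)
    (i0 : ι) (hi0 : i0 ∈ T) (hα0 : α i0 = 0) (hinj : ∀ i ∈ T, i ≠ i0 → α i ≠ 0)
    (hm : 2 ≤ T.card) (b : K) (Z : Finset K) (hZ1 : ∀ x ∈ Z, x ^ q = x + b)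
    (hZ2 : ∀ x ∈ Z, ∀ i ∈ T, x - α i ≠ 0)
    (hZ3 : ∀ x ∈ Z, ∀ j < r, ∏ i ∈ T, (x - α i) ^ (s * ((j * ε i) % r)) = 1)
    (hZc : Z.card ≤ q) : (Z.card : ℝ) ≤ (q : ℝ) / r + T.card * Real.sqrt q := by
  classical
  by_contra hcon
  push Not at hcon
  obtain ⟨N, hN⟩ : ∃ N, N = Z.card := ⟨_, rfl⟩
  obtain ⟨m, hmm⟩ : ∃ m, m = T.card := ⟨_, rfl⟩
  obtain ⟨M, hM⟩ : ∃ M, M = Nat.sqrt q := ⟨_, rfl⟩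
  obtain ⟨k, hk⟩ : ∃ k, k = (M * N - 1) / q + 1 := ⟨_, rfl⟩
  have hq0 : 0 < q := by omega
  have hMq : M ≤ q := hM ▸ Nat.sqrt_le_self q
  rw [← hN, ← hmm] at hcon
  have har := shadow_arith q r s m N M k hqs hr.two_le hs (hmm ▸ hm) hM (hN ▸ hZc) hcon hk
  let e : ℕ → ι → ℕ := fun j i => s * ((j * ε i) % r)
  let dg : ℕ → ℕ := fun j => ∑ i ∈ T, e j i
  let I : Finset (Σ _ : ℕ, ℕ) := (Finset.range r).sigma
    (fun j => (Finset.range (M * N - dg j)).filter (fun n => n % q < s))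
  have hI : ∀ y ∈ I, y.1 < r ∧ y.2 + dg y.1 < M * N ∧ y.2 % q < s := by
    intro y hy
    simp only [I, Finset.mem_sigma, Finset.mem_filter, Finset.mem_range] at hy
    omega
  let B : (Σ _ : ℕ, ℕ) → K[X] := fun y => X ^ y.2 * ∏ i ∈ T, (X - C (α i)) ^ e y.1 i
  let P : (Σ _ : ℕ, ℕ) → K[X][X] := fun y =>
    (C X + X * C (∏ i ∈ T, (X - C (α i)))) ^ (y.2 % q)
          * (∏ i ∈ T, (C 1 + X * C (∏ i' ∈ T.erase i, (X - C (α i')))) ^ e y.1 i)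
          * (C (X + C b) + X * C 0) ^ (y.2 / q)
  have hMN : 1 ≤ M * N := by
    by_contra h0
    have h0 : M * N = 0 := by omega
    have hsum : (0 : ℝ) ≤ s * (s * m * r * (r - 1) / 2) := by
      have : (1 : ℝ) ≤ r := by exact_mod_cast hr.one_le
      have : (0 : ℝ) ≤ r - 1 := by linarith
      positivity
    have hk1 : k = 1 := by rw [hk, h0]; simp
    have h0R : (M : ℝ) * N = 0 := by exact_mod_cast h0
    rw [h0R, hk1] at har
    have hN0 : (0 : ℝ) < N := lt_of_le_of_lt (by positivity) hcon
    have hM0 : (M : ℝ) = 0 := by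
      rcases mul_eq_zero.1 h0R with h | h
      · exact h
      · exact absurd h hN0.ne'
    rw [hM0] at har
    simp only [Nat.cast_one] at har
    nlinarith
  -- the weights
  have hW : ∀ y ∈ I, ShW (m - 1) (s + k - 2) (P y) := by
    intro y hy
    obtain ⟨_, h2, h3⟩ := hI y hy
    have hk1 : y.2 / q ≤ k - 1 := by
      rw [hk, Nat.add_sub_cancel]
      exact Nat.div_le_div_right (by omega)
    have hd : ∀ S : Finset ι, (∏ i ∈ S, (X - C (α i))).natDegree = S.card := by
      intro S
      rw [natDegree_prod_of_monic _ _ (fun i _ => monic_X_sub_C _)]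
      simp
    have w1 : ShW (m - 1) 1 (C X + X * C (∏ i ∈ T, (X - C (α i))) : K[X][X]) :=
      ShW.lin natDegree_X_le (by rw [hd]; omega)
    have w2 : ShW (m - 1) 1 (C (X + C b) + X * C 0 : K[X][X]) :=
      ShW.lin (by rw [natDegree_X_add_C]) (by simp)
    have w3 : ShW (m - 1) 0 (∏ i ∈ T, (C 1 + X * C (∏ i' ∈ T.erase i, (X - C (α i')))) ^ e y.1 i : K[X][X]) := by
      apply ShW.prod
      intro i hi
      have := (ShW.lin (e := m - 1) (d := 0) (a := (1 : K[X])) (b := ∏ i' ∈ T.erase i, (X - C (α i')))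
        (by simp) (by rw [hd, Finset.card_erase_of_mem hi]; omega)).pow (e y.1 i)
      simpa using this
    have hk2 : 1 ≤ k := hk ▸ Nat.le_add_left _ _
    refine (((w1.pow _).mul w3).mul (w2.pow _)).mono ?_
    generalize y.2 % q = u at *
    generalize y.2 / q = u' at *
    omega
  have hdgsum : (∑ j ∈ Finset.range r, (dg j : ℝ)) = s * m * r * (r - 1) / 2 := by
    have h1 : ∑ j ∈ Finset.range r, dg j = m * (s * ∑ j ∈ Finset.range r, j) := by
      simp only [dg, e]
      rw [Finset.sum_comm]
      rw [Finset.sum_congr rfl (g := fun _ => s * ∑ j ∈ Finset.range r, j)]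
      · rw [Finset.sum_const, smul_eq_mul, hmm]
      · intro i hi
        rw [← Finset.mul_sum, shadow_sum_mod r (ε i) hr (hε i hi).1 (hε i hi).2]
    have h2 : ((∑ j ∈ Finset.range r, j : ℕ) : ℝ) * 2 = r * (r - 1) := by
      have h := Finset.sum_range_id_mul_two r
      have h' : (((∑ j ∈ Finset.range r, j) * 2 : ℕ) : ℝ) = ((r * (r - 1) : ℕ) : ℝ) := by rw [h]
      rw [Nat.cast_mul, Nat.cast_mul, Nat.cast_sub hr.one_le] at h'
      simpa using h'
    rw [← Nat.cast_sum, h1, Nat.cast_mul, Nat.cast_mul]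
    linear_combination (s * m / 2 : ℝ) * h2
  have hIcard : (s : ℝ) * (r * (M * N) - s * m * r * (r - 1) / 2) ≤ q * I.card := by
    have h1 : ∀ j ∈ Finset.range r, (s : ℝ) * (M * N - dg j) ≤
        q * (((Finset.range (M * N - dg j)).filter (fun n => n % q < s)).card : ℝ) := by
      intro j _
      have h := shadow_count q s (M * N - dg j) (by nlinarith [hr.two_le]) hq0
      have h' : (s : ℝ) * ((M * N - dg j : ℕ) : ℝ) ≤
        q * (((Finset.range (M * N - dg j)).filter (fun n => n % q < s)).card : ℝ) := by exact_mod_cast h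
      refine le_trans ?_ h'
      apply mul_le_mul_of_nonneg_left _ (Nat.cast_nonneg _)
      have : M * N ≤ (M * N - dg j) + dg j := by omega
      have : (M : ℝ) * N ≤ ((M * N - dg j : ℕ) : ℝ) + dg j := by exact_mod_cast this
      linarith
    have h2 := Finset.sum_le_sum h1
    rw [← Finset.mul_sum, ← Finset.mul_sum, Finset.sum_sub_distrib, hdgsum] at h2
    rw [Finset.card_sigma, Nat.cast_sum]
    simpa using h2
  have hcond : ∑ l ∈ Finset.range M, ((s + k - 2) + l * (m - 1) + 1) < I.card := by
    have hk1 : 1 ≤ k := hk ▸ Nat.le_add_left _ _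
    have h2 : ((∑ j ∈ Finset.range M, j : ℕ) : ℝ) * 2 = M * (M - 1) := by
      rcases Nat.eq_zero_or_pos M with h0 | h0
      · rw [h0]; simp
      have h := Finset.sum_range_id_mul_two M
      have h' : (((∑ j ∈ Finset.range M, j) * 2 : ℕ) : ℝ) = ((M * (M - 1) : ℕ) : ℝ) := by rw [h]
      rw [Nat.cast_mul, Nat.cast_mul, Nat.cast_sub h0] at h'
      simpa using h'
    have h3 : ((∑ l ∈ Finset.range M, ((s + k - 2) + l * (m - 1) + 1) : ℕ) : ℝ)
        = M * ((s : ℝ) + k - 1) + ((m : ℝ) - 1) * M * (M - 1) / 2 := by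
      have h4 : ∑ l ∈ Finset.range M, ((s + k - 2) + l * (m - 1) + 1)
         = M * (s + k - 2 + 1) + (∑ l ∈ Finset.range M, l) * (m - 1) := by
        rw [Finset.sum_add_distrib, Finset.sum_add_distrib, ← Finset.sum_mul]
        simp; ring
      rw [h4]
      rw [show s + k - 2 + 1 = s + k - 1 by omega]
      rw [Nat.cast_add, Nat.cast_mul, Nat.cast_mul, Nat.cast_sub (by omega : 1 ≤ s + k),
        Nat.cast_sub (by omega : 1 ≤ m)]
      rw [Nat.cast_add, Nat.cast_one]
      linear_combination ((m : ℝ) - 1) / 2 * h2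
    rw [← h3] at har
    have h5 := lt_of_lt_of_le har hIcard
    have hqR : (0 : ℝ) < q := by exact_mod_cast hq0
    have h6 := lt_of_mul_lt_mul_left h5 hqR.le
    exact_mod_cast h6
  obtain ⟨c, hc0, hc⟩ := shadow_linalg I P (m - 1) (s + k - 2) M hW hcond
  obtain ⟨R, hR⟩ : ∃ R : K[X], R = ∑ y ∈ I, C (c y) * B y := ⟨_, rfl⟩
  -- R nonzero
  have hR0 : R ≠ 0 := by
    have := shadow_nonvanish I (fun y => y.2 + e y.1 i0)
      (fun y => ∏ i ∈ T.erase i0, (X - C (α i)) ^ e y.1 i) ?_ ?_ c hc0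
    · rw [hR]
      convert this using 3 with y hy
      simp only [B]
      rw [← Finset.mul_prod_erase T _ hi0, hα0, C_0, sub_zero, pow_add]
      ring
    · rintro ⟨j, n⟩ hy ⟨j', n'⟩ hy' hyy
      have h1 := hI _ hy
      have h2 := hI _ hy'
      simp only [e] at hyy h1 h2
      obtain ⟨u, hu⟩ : ∃ u, u = (j * ε i0) % r := ⟨_, rfl⟩
      obtain ⟨u', hu'⟩ : ∃ u, u = (j' * ε i0) % r := ⟨_, rfl⟩
      have hur : u < r := hu ▸ Nat.mod_lt _ hr.pos
      have hur' : u' < r := hu' ▸ Nat.mod_lt _ hr.pos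
      rw [← hu, ← hu'] at hyy
      have aux : ∀ n u, n % q < s → u < r → (n + s * u) % q / s = u := by
        intro n u hn hu
        have hlt : n % q + s * u < q := by
          have : s * (u + 1) ≤ s * r := Nat.mul_le_mul_left _ hu
          rw [mul_add, mul_one] at this
          rw [hqs, mul_comm r s] at *
          omega
        rw [Nat.add_mod, Nat.mod_eq_of_lt (a := s * u) (by omega), Nat.mod_eq_of_lt hlt,
          Nat.add_mul_div_left _ _ hs, Nat.div_eq_of_lt hn, zero_add]
      have huu : u = u' := by
        rw [← aux n u h1.2.2 hur, ← aux n' u' h2.2.2 hur', hyy]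
      have hjj : j = j' := by
        have hcop : Nat.Coprime r (ε i0) :=
          Nat.coprime_of_lt_prime (hε i0 hi0).1.ne' (hε i0 hi0).2 hr
        have : j * ε i0 ≡ j' * ε i0 [MOD r] := by
          unfold Nat.ModEq; rw [← hu, ← hu', huu]
        exact Nat.ModEq.eq_of_lt_of_lt (Nat.ModEq.cancel_right_of_coprime hcop this) h1.1 h2.1
      have hnn : n = n' := by rw [huu] at hyy; omega
      rw [hjj, hnn]
    · intro y _
      rw [coeff_zero_eq_eval_zero, eval_prod]
      apply Finset.prod_ne_zero_iff.2
      intro i hi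
      rw [Finset.mem_erase] at hi
      simp only [eval_pow, eval_sub, eval_X, eval_C, zero_sub]
      exact pow_ne_zero _ (neg_ne_zero.2 (hinj i hi.2 hi.1))
  have hRdeg : R.natDegree < M * N := by
    have : R.natDegree ≤ M * N - 1 := by
      rw [hR]
      apply natDegree_sum_le_of_forall_le
      intro y hy
      have h := hI y hy
      refine (natDegree_C_mul_le _ _).trans (natDegree_mul_le.trans ?_)
      rw [natDegree_X_pow, natDegree_prod_of_monic _ _ (fun i _ => (monic_X_sub_C _).pow _)]
      have : ∑ i ∈ T, ((X - C (α i)) ^ e y.1 i).natDegree = dg y.1 := by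
        simp [dg]
      omega
    omega
  have hdvd : ∀ x ∈ Z, (X - C x) ^ M ∣ R := by
    intro x hx
    apply shadow_untranslate R x (∏ i ∈ T, (x - α i)) (Finset.prod_ne_zero_iff.2 (hZ2 x hx))
    have h1 : X ^ M ∣ (∑ y ∈ I, C (C (c y)) * P y).map (evalRingHom x) := by
      rw [X_pow_dvd_iff]
      intro l hl
      rw [coeff_map, hc l hl, map_zero]
    have h2 : R.comp (C x + X * C (∏ i ∈ T, (x - α i))) =
        (∑ y ∈ I, C (c y) * ((B y).comp (C x + X * C (∏ i ∈ T, (x - α i))) - (P y).map (evalRingHom x)))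
          + (∑ y ∈ I, C (C (c y)) * P y).map (evalRingHom x) := by
      rw [hR, Polynomial.sum_comp, Polynomial.map_sum, ← Finset.sum_add_distrib]
      apply Finset.sum_congr rfl
      intro y _
      have h3 : (C (C (c y)) * P y).map (evalRingHom x) = C (c y) * (P y).map (evalRingHom x) := by
        rw [Polynomial.map_mul, map_C]
        simp only [coe_evalRingHom, eval_C]
      rw [mul_comp, C_comp, h3]
      ring
    rw [h2]
    refine dvd_add (Finset.dvd_sum fun y hy => Dvd.dvd.mul_left ?_ _) h1
    exact shadow_local q M y.2 hMq hfrob T α (e y.1) b x (hZ1 x hx) (hZ3 x hx y.1 (hI y hy).1)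
  have hprod : ∏ x ∈ Z, (X - C x) ^ M ∣ R := by
    apply Finset.prod_dvd_of_coprime _ hdvd
    intro x _ y _ hxy
    exact (pairwise_coprime_X_sub_C Function.injective_id hxy).pow
  have hle := natDegree_le_of_dvd hprod hR0
  rw [natDegree_prod_of_monic _ _ (fun i _ => (monic_X_sub_C _).pow _)] at hle
  simp only [natDegree_pow, natDegree_X_sub_C, mul_one, Finset.sum_const, smul_eq_mul] at hle
  rw [← hN, mul_comm] at hle
  omega

lemma shadow_stepanov {K : Type*} [Field K] {ι : Type*} [DecidableEq ι] (q r s : ℕ) (hr : r.Prime)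
    (hqs : q = r * s + 1) (hs : 1 ≤ s)
    (hfrob : ∀ A B : K[X], (A + B) ^ q = A ^ q + B ^ q)
    (T : Finset ι) (α : ι → K) (ε : ι → ℕ) (hε : ∀ i ∈ T, 0 < ε i ∧ ε i < r)
    (hinj : ∀ i ∈ T, ∀ i' ∈ T, α i = α i' → i = i')
    (hm : 2 ≤ T.card) (Z : Finset K) (hZ1 : ∀ x ∈ Z, x ^ q = x)
    (hZ2 : ∀ x ∈ Z, ∀ i ∈ T, x - α i ≠ 0)
    (hZ3 : ∀ x ∈ Z, ∀ j < r, ∏ i ∈ T, (x - α i) ^ (s * ((j * ε i) % r)) = 1)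
    (hZc : Z.card ≤ q) : (Z.card : ℝ) ≤ (q : ℝ) / r + T.card * Real.sqrt q := by
  classical
  obtain ⟨i0, hi0⟩ : T.Nonempty := Finset.card_pos.1 (by omega)
  have hsub : ∀ x y : K, (x - y) ^ q = x ^ q - y ^ q := by
    intro x y
    have h := hfrob (C (x - y)) (C y)
    rw [← C_add, ← C_pow, ← C_pow, ← C_pow, ← C_add, C_inj, sub_add_cancel] at h
    rw [h]; ring
  have hZi : (Z.image (fun x => x - α i0)).card = Z.card :=
    Finset.card_image_of_injective _ (sub_left_injective)
  have := shadow_stepanov0 q r s hr hqs hs hfrob T (fun i => α i - α i0) ε hε i0 hi0 (sub_self _)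
    (fun i hi hne h => hne (hinj i hi i0 hi0 (sub_eq_zero.1 h))) hm (α i0 - α i0 ^ q)
    (Z.image (fun x => x - α i0)) ?_ ?_ ?_ (by rw [hZi]; exact hZc)
  · rwa [hZi] at this
  · intro x hx
    obtain ⟨y, hy, rfl⟩ := Finset.mem_image.1 hx
    rw [hsub, hZ1 y hy]; ring
  · intro x hx i hi
    obtain ⟨y, hy, rfl⟩ := Finset.mem_image.1 hx
    simpa using hZ2 y hy i hi
  · intro x hx j hj
    obtain ⟨y, hy, rfl⟩ := Finset.mem_image.1 hx
    simpa using hZ3 y hy j hj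

/-- An element in the kernel of a character of order `r` is an `r`-th power. -/
lemma shadow_ker {F : Type} [Field F] [Fintype F] (r s : ℕ) (hr : r.Prime)
    (hqs : Fintype.card F = r * s + 1) (χ : Fˣ →* (rootsOfUnity r ℂ)) (hχord : orderOf χ = r)
    (u : Fˣ) (hu : χ u = 1) : u ^ s = 1 := by
  have : NeZero r := ⟨hr.ne_zero⟩
  have h1 : Nat.card χ.range ∣ r := by
    have := Subgroup.card_subgroup_dvd_card χ.range
    rwa [Complex.card_rootsOfUnity] at this
  have h2 : Nat.card χ.range = r := by
    rcases (Nat.dvd_prime hr).1 h1 with h | h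
    · exfalso
      have hb : χ.range = ⊥ := Subgroup.eq_bot_of_card_eq _ h
      have : χ = 1 := (MonoidHom.range_eq_bot_iff).1 hb
      rw [this, orderOf_one] at hχord
      exact hr.one_lt.ne hχord
    · exact h
  have h3 := Subgroup.card_mul_index χ.ker
  rw [Subgroup.index_ker, h2, Nat.card_units, Nat.card_eq_fintype_card (α := F), hqs, Nat.add_sub_cancel,
    mul_comm r s] at h3
  have h4 : Nat.card χ.ker = s := Nat.eq_of_mul_eq_mul_right hr.pos h3
  have h5 := Subgroup.orderOf_dvd_natCard χ.ker (x := u) hu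
  rw [h4] at h5
  exact orderOf_dvd_iff_pow_eq_one.1 h5

lemma shadow_weil {F : Type} [Field F] [Fintype F] (q r s L : ℕ) (hr : r.Prime)
    (hq : Fintype.card F = q) (hqs : q = r * s + 1) (hs : 1 ≤ s)
    (p : Fin L → F[X]) (hmon : ∀ i, (p i).Monic)
    (hirr : ∀ i, Irreducible (p i)) (hdist : Function.Injective p)
    (hdeg : ∀ i, 2 ≤ (p i).natDegree)
    (hnz : ∀ i (x : F), (p i).eval x ≠ 0) (w : Fin L → ℕ) (hw : ∀ i, w i < r) (hw0 : ∃ i, w i ≠ 0)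
    (Z : Finset F) (hZ : ∀ x ∈ Z, (∏ i, (p i).eval x ^ w i) ^ s = 1) :
    (Z.card : ℝ) ≤ (q : ℝ) / r +
      (L : ℝ) * (Finset.univ.sup fun i => (p i).natDegree : ℕ) * Real.sqrt q := by
  classical
  let K := AlgebraicClosure F
  let f : F →+* K := algebraMap F K
  have hnd : ∀ i, ((p i).map f).roots.Nodup := fun i =>
    nodup_roots (PerfectField.separable_of_irreducible (hirr i)).map
  let S : Fin L → Finset K := fun i => ⟨((p i).map f).roots, hnd i⟩
  have hS : ∀ i α, α ∈ S i → aeval α (p i) = 0 := by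
    intro i α h
    have h' : α ∈ ((p i).map f).roots := h
    rw [mem_roots ((hmon i).map f).ne_zero, IsRoot.def, eval_map] at h'
    exact h'
  have hScard : ∀ i, (S i).card = (p i).natDegree := by
    intro i
    have := (IsAlgClosed.splits ((p i).map f)).natDegree_eq_card_roots
    rw [natDegree_map] at this
    exact this.symm
  have hSprod : ∀ i (x : F), ∏ α ∈ S i, (f x - α) = f ((p i).eval x) := by
    intro i x
    have := (IsAlgClosed.splits ((p i).map f)).eval_eq_prod_roots_of_monic ((hmon i).map f) (f x)
    rw [eval_map, eval₂_at_apply] at this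
    rw [this]
    rfl
  let T : Finset (Σ _ : Fin L, K) := (Finset.univ.filter (fun i => w i ≠ 0)).sigma S
  have hT : ∀ y ∈ T, w y.1 ≠ 0 ∧ y.2 ∈ S y.1 := by
    intro y hy
    simpa [T] using hy
  have hTcard : T.card = ∑ i ∈ Finset.univ.filter (fun i => w i ≠ 0), (p i).natDegree := by
    rw [Finset.card_sigma]; exact Finset.sum_congr rfl fun i _ => hScard i
  obtain ⟨pp, hchar, n, hpp, hcard⟩ := FiniteField.card' F
  have : Fact pp.Prime := ⟨hpp⟩
  have : CharP K pp := charP_of_injective_algebraMap (algebraMap F K).injective pp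
  have hqp : q = pp ^ (n : ℕ) := by rw [← hq, hcard]
  have hZi : (Z.image f).card = Z.card := Finset.card_image_of_injective _ f.injective
  have hmain := shadow_stepanov q r s hr hqs hs
    (fun A B => by rw [hqp]; exact add_pow_char_pow A B pp n)
    T (fun y => y.2) (fun y => w y.1) (fun y hy => ⟨Nat.pos_of_ne_zero (hT y hy).1, hw _⟩)
    ?_ ?_ (Z.image f) ?_ ?_ ?_ ?_
  · rw [hZi] at hmain
    refine hmain.trans ?_
    have hle : T.card ≤ L * (Finset.univ.sup fun i => (p i).natDegree) := by
      rw [hTcard]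
      refine (Finset.sum_le_card_nsmul _ _ (Finset.univ.sup fun i => (p i).natDegree)
        (fun i _ => Finset.le_sup (f := fun i => (p i).natDegree) (Finset.mem_univ i))).trans ?_
      rw [smul_eq_mul]
      apply Nat.mul_le_mul_right
      exact (Finset.card_le_univ _).trans (by simp)
    have hle' : (T.card : ℝ) ≤ (L : ℝ) * (Finset.univ.sup fun i => (p i).natDegree : ℕ) := by
      exact_mod_cast hle
    have := mul_le_mul_of_nonneg_right hle' (Real.sqrt_nonneg (q : ℝ))
    linarith
  · rintro ⟨i, a⟩ hy ⟨i', a'⟩ hy' haa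
    simp only at haa
    subst haa
    have h1 := minpoly.eq_of_irreducible_of_monic (hirr i) (hS i a (hT _ hy).2) (hmon i)
    have h2 := minpoly.eq_of_irreducible_of_monic (hirr i') (hS i' a (hT _ hy').2) (hmon i')
    have : i = i' := hdist (h1.trans h2.symm)
    rw [this]
  · obtain ⟨i, hi⟩ := hw0
    rw [hTcard]
    exact (hdeg i).trans (Finset.single_le_sum (f := fun i => (p i).natDegree)
      (fun _ _ => Nat.zero_le _) (by simp [hi]))
  · intro x hx
    obtain ⟨y, _, rfl⟩ := Finset.mem_image.1 hx
    rw [← map_pow, ← hq, FiniteField.pow_card]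
  · intro x hx y hy h0
    obtain ⟨z, _, rfl⟩ := Finset.mem_image.1 hx
    have h1 := hSprod y.1 z
    rw [Finset.prod_eq_zero (hT y hy).2 h0] at h1
    exact hnz y.1 z (f.injective (by rw [← h1, map_zero]))
  · intro x hx j _
    obtain ⟨z, hz, rfl⟩ := Finset.mem_image.1 hx
    rw [Finset.prod_sigma]
    have h1 : ∀ i, ∏ a ∈ S i, (f z - a) ^ (s * ((j * w i) % r)) = f ((p i).eval z ^ w i) ^ (s * j) := by
      intro i
      rw [Finset.prod_pow, hSprod, ← map_pow, ← map_pow, ← pow_mul]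
      congr 1
      have h2 : (p i).eval z ^ (r * s) = 1 := by
        have := FiniteField.pow_card_sub_one_eq_one _ (hnz i z)
        rwa [hq, hqs, Nat.add_sub_cancel] at this
      have h3 : w i * (s * j) = s * ((j * w i) % r) + (r * s) * ((j * w i) / r) := by
        conv_lhs => rw [show w i * (s * j) = s * (j * w i) by ring, ← Nat.mod_add_div (j * w i) r]
        ring
      rw [h3, pow_add, pow_mul _ (r * s), h2, one_pow, mul_one]
    have h4 : ∏ i ∈ Finset.univ.filter (fun i => w i ≠ 0), f ((p i).eval z ^ w i) ^ (s * j)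
        = ∏ i, f ((p i).eval z ^ w i) ^ (s * j) := by
      rw [Finset.prod_filter]
      apply Finset.prod_congr rfl
      intro i _
      split_ifs with h
      · rfl
      · rw [not_not.1 h]; simp
    simp only [h1]
    rw [h4, Finset.prod_pow, ← map_prod, pow_mul, ← map_pow, hZ z hz, map_one, one_pow]
  · rw [hZi, ← hq]; exact Finset.card_le_univ _

end

/-- The minimum distance of the `(r,P)`-shadow code of length `n = q`
is at least `(r-1)q/r − L·max deg pᵢ·√q`. -/
theorem shadow_code_min_distance
    (r q L : ℕ) (hr : r.Prime) (F : Type) [Field F] [Fintype F]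
    (hq : Fintype.card F = q) (hq3 : 3 ≤ q)
    (hpp : ∃ p k : ℕ, p.Prime ∧ 0 < k ∧ q = p ^ k) (hdvd : r ∣ q - 1)
    (χ : Fˣ →* (rootsOfUnity r ℂ)) (hχord : orderOf χ = r)
    (φ : (rootsOfUnity r ℂ) → ZMod r)
    (hφbij : Function.Bijective φ)
    (hφadd : ∀ a b : (rootsOfUnity r ℂ), φ (a * b) = φ a + φ b)
    (p : Fin L → Polynomial F) (hmon : ∀ i, (p i).Monic)
    (hirr : ∀ i, Irreducible (p i)) (hdist : Function.Injective p)
    (hdeg : ∀ i, 2 ≤ (p i).natDegree)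
    (hnz : ∀ i (x : F), (p i).eval x ≠ 0) :
    ∀ c ∈ Set.range (shadowEv χ φ p hnz), ∀ c' ∈ Set.range (shadowEv χ φ p hnz),
      c ≠ c' →
      ((r : ℝ) - 1) * q / r
          - (L : ℝ) * (Finset.univ.sup fun i => (p i).natDegree : ℕ) * Real.sqrt q
        ≤ (hammingDist c c' : ℝ) := by
  have : NeZero r := ⟨hr.ne_zero⟩
  obtain ⟨s, hs⟩ := hdvd
  have hqs : q = r * s + 1 := by omega
  have hs1 : 1 ≤ s := by
    rcases Nat.eq_zero_or_pos s with h | h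
    · rw [h] at hqs; omega
    · exact h
  rintro _ ⟨v, rfl⟩ _ ⟨v', rfl⟩ hne
  have hw0 : ∃ i, (v i - v' i).val ≠ 0 := by
    by_contra h
    push Not at h
    apply hne
    have : v = v' := by
      funext i
      exact sub_eq_zero.1 ((ZMod.val_eq_zero _).1 (h i))
    rw [this]
  have hmain := shadow_weil q r s L hr hq hqs hs1 p hmon hirr hdist hdeg hnz
    (fun i => (v i - v' i).val) (fun i => ZMod.val_lt _) hw0
    (Finset.univ.filter (fun x => shadowEv χ φ p hnz v x = shadowEv χ φ p hnz v' x)) ?_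
  · have h1 : hammingDist (shadowEv χ φ p hnz v) (shadowEv χ φ p hnz v')
        + (Finset.univ.filter (fun x => shadowEv χ φ p hnz v x = shadowEv χ φ p hnz v' x)).card = q := by
      unfold hammingDist
      rw [← hq, add_comm]
      exact Finset.card_filter_add_card_filter_not _
    have h2 : (hammingDist (shadowEv χ φ p hnz v) (shadowEv χ φ p hnz v') : ℝ)
        + ((Finset.univ.filter (fun x => shadowEv χ φ p hnz v x = shadowEv χ φ p hnz v' x)).card : ℝ)
          = q := by exact_mod_cast h1
    have hr0 : (r : ℝ) ≠ 0 := by exact_mod_cast hr.ne_zero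
    have h3 : ((r : ℝ) - 1) * q / r = q - q / r := by field_simp
    rw [h3]
    linarith
  · intro x hx
    rw [Finset.mem_filter] at hx
    have h1 := hφbij.1 hx.2
    have h2 : χ (∏ i, (Units.mk0 ((p i).eval x) (hnz i x)) ^ (v i - v' i).val) = 1 := by
      rw [map_prod, map_prod] at h1
      rw [map_prod]
      have h3 : ∀ i, χ ((Units.mk0 ((p i).eval x) (hnz i x)) ^ (v i).val)
          = χ ((Units.mk0 ((p i).eval x) (hnz i x)) ^ (v i - v' i).val)
            * χ ((Units.mk0 ((p i).eval x) (hnz i x)) ^ (v' i).val) := by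
        intro i
        rw [← map_mul, ← pow_add, map_pow, map_pow]
        have h4 : (χ (Units.mk0 ((p i).eval x) (hnz i x))) ^ r = 1 := by
          have h7 : χ ^ r = 1 := orderOf_dvd_iff_pow_eq_one.1 (dvd_of_eq hχord)
          rw [← MonoidHom.pow_apply, h7, MonoidHom.one_apply]
        rw [pow_eq_pow_mod ((v i - v' i).val + (v' i).val) h4, ← ZMod.val_add, sub_add_cancel]
      rw [Finset.prod_congr rfl (fun i _ => h3 i), Finset.prod_mul_distrib] at h1
      exact mul_eq_right.1 h1
    have h5 := shadow_ker r s hr (hq.trans hqs) χ hχord _ h2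
    have h6 := congrArg (fun u : Fˣ => (u : F)) h5
    simpa using h6
end
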